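/- arXiv:2203.08466 — 9 statements merged into one kernel-verified Lean document; each statement's English description precedes it below -/
import Mathlib

section
/- Let (G,X) be a flow. The orbit closure map O: X → 2^X, x ↦ cl(Gx), is ⌐continuous⌐ if and only if the orbit closure relation R_o is closed in X × X. -/
/-!
STATEMENT 1. For a flow (G,X), the orbit closure map `x ↦ cl(Gx)` is ⌐continuous⌐ iff the
orbit closure relation `R_o` is closed in `X × X`.
-/

universe u

open MulAction

/-- Convergence of a net `p : ι → Z` to `y`. -/
def NetConv {Z : Type u} [TopologicalSpace Z] {ι : Type u} [Preorder ι]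
    (p : ι → Z) (y : Z) : Prop :=
  ∀ U ∈ nhds y, ∃ i₀, ∀ i, i₀ ≤ i → p i ∈ U

/-- `HLimMem Y y` : there are a subnet `{Y (φ k)}` of the net of sets `{Y i}` and points
`p k ∈ Y (φ k)` with `p k → y`. -/
def HLimMem {Z : Type u} [TopologicalSpace Z] {ι : Type u} [Preorder ι]
    (Y : ι → Set Z) (y : Z) : Prop :=
  ∃ (κ : Type u) (pk : Preorder κ),
    Nonempty κ ∧ IsDirected κ pk.le ∧
    ∃ (φ : κ → ι) (p : κ → Z),
      (∀ i, ∃ k₀, ∀ k, pk.le k₀ k → i ≤ φ k) ∧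
      (∀ k, p k ∈ Y (φ k)) ∧
      (∀ U ∈ nhds y, ∃ k₀, ∀ k, pk.le k₀ k → p k ∈ U)

/-- `HLim Y K` : the net of sets `{Y i}` converges to `K`, i.e. `Y_i ⇀ K`. -/
def HLim {Z : Type u} [TopologicalSpace Z] {ι : Type u} [Preorder ι]
    (Y : ι → Set Z) (K : Set Z) : Prop :=
  K = {y | HLimMem Y y}

/-- The orbit closure map `O : X → 2^X`, `x ↦ cl(Gx)`, is ⌐continuous⌐ : whenever `x_i → x`
in `X` and `cl(Gx_i) ⇀ K` in `2^X`, then `cl(Gx) = K`. -/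
def OrbitMapHCont (G X : Type u) [Group G] [TopologicalSpace X] [MulAction G X] : Prop :=
  ∀ (ι : Type u) [Preorder ι] [Nonempty ι] [IsDirected ι (· ≤ ·)],
    ∀ (x : ι → X) (x₀ : X) (K : Set X),
      NetConv x x₀ → HLim (fun i => closure (orbit G (x i))) K →
      closure (orbit G x₀) = K

/-- A point all of whose neighbourhoods frequently meet the sets `Y i` is a limit of points of a
subnet. -/
theorem HLimMem.of_frequently {Z : Type u} [TopologicalSpace Z] {ι : Type u} [Preorder ι]
    [Nonempty ι] [IsDirected ι (· ≤ ·)] {Y : ι → Set Z} {y : Z}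
    (h : ∀ U ∈ nhds y, ∀ i, ∃ j, i ≤ j ∧ (Y j ∩ U).Nonempty) : HLimMem Y y := by
  have h' : ∀ k : ι × {U : (Set Z)ᵒᵈ // OrderDual.ofDual U ∈ nhds y},
      ∃ j, ∃ z, k.1 ≤ j ∧ z ∈ Y j ∧ z ∈ OrderDual.ofDual k.2.1 := by
    rintro ⟨i, U, hU⟩
    obtain ⟨j, hij, z, hzY, hzU⟩ := h _ hU i
    exact ⟨j, z, hij, hzY, hzU⟩
  choose φ p hφ hpY hpU using h'
  obtain ⟨i₀⟩ := ‹Nonempty ι›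
  refine ⟨_, inferInstance, ⟨⟨i₀, ⟨OrderDual.toDual Set.univ, Filter.univ_mem⟩⟩⟩, ⟨?_⟩,
    φ, p, ?_, hpY, ?_⟩
  · rintro ⟨i, U, hU⟩ ⟨j, V, hV⟩
    obtain ⟨l, hil, hjl⟩ := exists_ge_ge i j
    exact ⟨⟨l, OrderDual.toDual (OrderDual.ofDual U ∩ OrderDual.ofDual V),
      Filter.inter_mem hU hV⟩, ⟨hil, Set.inter_subset_left⟩, ⟨hjl, Set.inter_subset_right⟩⟩
  · intro i
    exact ⟨⟨i, ⟨OrderDual.toDual Set.univ, Filter.univ_mem⟩⟩, fun k hk => hk.1.trans (hφ k)⟩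
  · intro U hU
    exact ⟨⟨i₀, ⟨OrderDual.toDual U, hU⟩⟩, fun k hk => hk.2 (hpU k)⟩

/-- A point of the closure of a set is the limit of a net of points of the set. -/
theorem exists_netConv_of_mem_closure {Z : Type u} [TopologicalSpace Z] {s : Set Z} {z : Z}
    (hz : z ∈ closure s) :
    ∃ (ι : Type u) (_ : Preorder ι) (_ : Nonempty ι) (_ : IsDirected ι (· ≤ ·)) (p : ι → Z),
      (∀ i, p i ∈ s) ∧ NetConv p z := by
  have h : ∀ U : {U : (Set Z)ᵒᵈ // OrderDual.ofDual U ∈ nhds z},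
      ∃ w, w ∈ OrderDual.ofDual U.1 ∧ w ∈ s := fun U => mem_closure_iff_nhds.1 hz _ U.2
  choose p hpU hps using h
  refine ⟨_, inferInstance, ⟨⟨OrderDual.toDual Set.univ, Filter.univ_mem⟩⟩, ⟨?_⟩, p, hps, ?_⟩
  · rintro ⟨U, hU⟩ ⟨V, hV⟩
    exact ⟨⟨OrderDual.toDual (OrderDual.ofDual U ∩ OrderDual.ofDual V),
      Filter.inter_mem hU hV⟩, Set.inter_subset_left, Set.inter_subset_right⟩
  · intro U hU
    exact ⟨⟨OrderDual.toDual U, hU⟩, fun i hi => hi (hpU i)⟩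

/-- If the orbit closure relation is closed, limits of points of the orbit closures of a convergent
net lie in the orbit closure of the limit. -/
theorem HLimMem.mem_closure_orbit {G X : Type u} [Group G] [TopologicalSpace X] [MulAction G X]
    (hR : IsClosed {p : X × X | p.2 ∈ closure (orbit G p.1)})
    {ι : Type u} [Preorder ι] {x : ι → X} {x₀ y : X} (hx : NetConv x x₀)
    (hy : HLimMem (fun i => closure (orbit G (x i))) y) : y ∈ closure (orbit G x₀) := by
  obtain ⟨κ, pk, -, hdir, φ, p, hφ, hpY, hp⟩ := hy
  suffices h : (x₀, y) ∈ closure {p : X × X | p.2 ∈ closure (orbit G p.1)} by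
    rwa [hR.closure_eq] at h
  refine mem_closure_iff_nhds.2 fun W hW => ?_
  obtain ⟨U, hU, V, hV, hUV⟩ := mem_nhds_prod_iff.1 hW
  obtain ⟨i₀, hi₀⟩ := hx U hU
  obtain ⟨k₁, hk₁⟩ := hφ i₀
  obtain ⟨k₂, hk₂⟩ := hp V hV
  obtain ⟨k, h₁, h₂⟩ := hdir.directed k₁ k₂
  exact ⟨(x (φ k), p k), hUV ⟨hi₀ _ (hk₁ k h₁), hk₂ k h₂⟩, hpY k⟩

/-- Points of the orbit closure of the limit of a net are limits of points of the orbit closures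
along the net. -/
theorem HLimMem.of_mem_closure_orbit {G X : Type u} [Group G] [TopologicalSpace X] [MulAction G X]
    [ContinuousConstSMul G X] {ι : Type u} [Preorder ι] [Nonempty ι] [IsDirected ι (· ≤ ·)]
    {x : ι → X} {x₀ y : X} (hx : NetConv x x₀) (hy : y ∈ closure (orbit G x₀)) :
    HLimMem (fun i => closure (orbit G (x i))) y := by
  refine HLimMem.of_frequently fun U hU i => ?_
  obtain ⟨_, hgU, g, rfl⟩ := mem_closure_iff_nhds.1 hy _ (interior_mem_nhds.2 hU)
  obtain ⟨i₀, hi₀⟩ := hx _ ((continuous_const_smul g).continuousAt.preimage_mem_nhds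
    (isOpen_interior.mem_nhds hgU))
  obtain ⟨j, hij, hj⟩ := exists_ge_ge i i₀
  exact ⟨j, hij, g • x j, subset_closure (mem_orbit _ g), interior_subset (hi₀ j hj)⟩

theorem stmt_1 {G X : Type u}
    [Group G] [TopologicalSpace G] [T2Space G] [ContinuousMul G]
    [TopologicalSpace X] [T2Space X] [LocallyCompactSpace X]
    [MulAction G X] [ContinuousSMul G X]
    (horb : ∀ x : X, IsCompact (closure (orbit G x))) :
    OrbitMapHCont G X ↔ IsClosed {p : X × X | p.2 ∈ closure (orbit G p.1)} := by
  constructor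
  · intro h
    refine isClosed_of_closure_subset ?_
    rintro ⟨x₀, y⟩ hxy
    obtain ⟨ι, _, _, hdir, p, hpR, hp⟩ := exists_netConv_of_mem_closure hxy
    have hx : NetConv (fun i => (p i).1) x₀ := fun U hU =>
      hp _ (continuous_fst.continuousAt.preimage_mem_nhds hU)
    have hy : NetConv (fun i => (p i).2) y := fun U hU =>
      hp _ (continuous_snd.continuousAt.preimage_mem_nhds hU)
    change y ∈ closure (orbit G x₀)
    rw [h ι _ x₀ _ hx rfl]
    exact ⟨ι, inferInstance, inferInstance, hdir, id, fun i => (p i).2,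
      fun i => ⟨i, fun _ hk => hk⟩, hpR, hy⟩
  · intro hR ι _ _ _ x x₀ K hx hK
    rw [hK]
    exact Set.Subset.antisymm (fun _ hy => HLimMem.of_mem_closure_orbit hx hy)
      (fun _ hy => HLimMem.mem_closure_orbit hR hx hy)
end

section
/- Let (G,X) be a flow with X compact. Then the following are pairwise equivalent: (a) the orbit closure map O: X → 2^X, x ↦ cl(Gx), is ⌐continuous⌐; (b) O is upper semicontinuous; (c) O is continuous with respect to the Vietoris topology on the space of nonempty closed subsets of X; (d) the orbit closure relation R_o is closed in X × X. -/
/-!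
STATEMENT 2. For a flow (G,X) with X compact, the following are equivalent:
(a) the orbit closure map is ⌐continuous⌐; (b) it is upper semicontinuous;
(c) it is continuous for the Vietoris topology on the nonempty closed subsets of X;
(d) the orbit closure relation `R_o` is closed in `X × X`.
-/

universe u

open MulAction

/-- The orbit closure map is upper semicontinuous: for every `x` and every open
`V ⊇ cl(Gx)` there is a neighborhood `U` of `x` with `cl(Gy) ⊆ V` for all `y ∈ U`. -/
def OrbitMapUSC (G X : Type u) [Group G] [TopologicalSpace X] [MulAction G X] : Prop :=
  ∀ (x : X) (V : Set X), IsOpen V → closure (orbit G x) ⊆ V →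
    ∃ U ∈ nhds x, ∀ y ∈ U, closure (orbit G y) ⊆ V

/-- The space `2^X` of nonempty closed subsets of `X`. -/
def ClosedsNE (X : Type u) [TopologicalSpace X] : Type u :=
  {C : Set X // C.Nonempty ∧ IsClosed C}

/-- The Vietoris topology on `2^X`, generated by the sets `{C | C ⊆ U}` and
`{C | C ∩ U ≠ ∅}` for `U ⊆ X` open. -/
def vietorisTop (X : Type u) [TopologicalSpace X] : TopologicalSpace (ClosedsNE X) :=
  TopologicalSpace.generateFrom
    ({s | ∃ U : Set X, IsOpen U ∧ s = {C : ClosedsNE X | C.1 ⊆ U}} ∪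
     {s | ∃ U : Set X, IsOpen U ∧ s = {C : ClosedsNE X | (C.1 ∩ U).Nonempty}})

/-- The orbit closure map `X → 2^X`, `x ↦ cl(Gx)`. -/
def orbitClosureMap (G X : Type u) [Group G] [TopologicalSpace X] [MulAction G X] :
    X → ClosedsNE X :=
  fun x => ⟨closure (orbit G x),
    ⟨x, subset_closure (MulAction.mem_orbit_self x)⟩, isClosed_closure⟩

open Topology TopologicalSpace

/-- A point is a limit of a subnet of points of `Y i` iff the sets `Y i` frequently meet each of its
neighborhoods. -/
theorem hLimMem_iff {Z : Type u} [TopologicalSpace Z] {ι : Type u} [Preorder ι] [Nonempty ι]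
    [IsDirected ι (· ≤ ·)] {Y : ι → Set Z} {y : Z} :
    HLimMem Y y ↔ ∀ i₀, ∀ U ∈ 𝓝 y, ∃ i, i₀ ≤ i ∧ (Y i ∩ U).Nonempty := by
  constructor
  · rintro ⟨κ, pk, -, hdir, φ, p, hφ, hp, hconv⟩ i₀ U hU
    obtain ⟨k₁, hk₁⟩ := hφ i₀
    obtain ⟨k₂, hk₂⟩ := hconv U hU
    obtain ⟨k, h₁, h₂⟩ := hdir.directed k₁ k₂
    exact ⟨φ k, hk₁ k h₁, p k, hp k, hk₂ k h₂⟩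
  · intro h
    choose φ hφ p hp using fun k : ι × (OpenNhdsOf y)ᵒᵈ =>
      h k.1 ((OrderDual.ofDual k.2 : OpenNhdsOf y) : Set Z)
        ((OrderDual.ofDual k.2).isOpen.mem_nhds (OrderDual.ofDual k.2).mem)
    obtain ⟨i₁⟩ := ‹Nonempty ι›
    refine ⟨ι × (OpenNhdsOf y)ᵒᵈ, inferInstance, ⟨(i₁, OrderDual.toDual ⊤)⟩, ⟨fun a b => ?_⟩,
      φ, p, fun i => ⟨(i, OrderDual.toDual ⊤), fun k hk => hk.1.trans (hφ k)⟩, fun k => (hp k).1,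
      fun U hU => ?_⟩
    · obtain ⟨i, ha, hb⟩ := exists_ge_ge a.1 b.1
      exact ⟨(i, a.2 ⊔ b.2), ⟨ha, le_sup_left⟩, ⟨hb, le_sup_right⟩⟩
    · obtain ⟨V, hVU, hV, hyV⟩ := mem_nhds_iff.1 hU
      exact ⟨(i₁, OrderDual.toDual ⟨⟨V, hV⟩, hyV⟩), fun k hk => hVU (hk.2 (hp k).2)⟩

section OrbitClosure

variable {G X : Type u} [Group G] [TopologicalSpace X] [MulAction G X]

theorem OrbitMapHCont.isClosed_rel (h : OrbitMapHCont G X) :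
    IsClosed {p : X × X | p.2 ∈ closure (orbit G p.1)} := by
  refine isClosed_of_closure_subset fun ⟨x, y⟩ hxy => ?_
  rw [mem_closure_iff_nhds] at hxy
  choose q hq hqR using fun W : (OpenNhdsOf (x, y))ᵒᵈ =>
    hxy ((OrderDual.ofDual W : OpenNhdsOf (x, y)) : Set (X × X))
      ((OrderDual.ofDual W).isOpen.mem_nhds (OrderDual.ofDual W).mem)
  have hconv : NetConv q (x, y) := by
    intro U hU
    obtain ⟨V, hVU, hV, hyV⟩ := mem_nhds_iff.1 hU
    exact ⟨OrderDual.toDual ⟨⟨V, hV⟩, hyV⟩, fun W hW => hVU (hW (hq W))⟩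
  have hlim := h _ (fun W => (q W).1) x _
    (fun U hU => hconv _ (continuous_fst.continuousAt.preimage_mem_nhds hU)) rfl
  change y ∈ closure (orbit G x)
  rw [hlim, Set.mem_ofPred_eq, hLimMem_iff]
  intro W₀ U hU
  obtain ⟨W₁, hW₁⟩ := hconv _ (continuous_snd.continuousAt.preimage_mem_nhds hU)
  exact ⟨W₀ ⊔ W₁, le_sup_left, _, hqR _, hW₁ _ le_sup_right⟩

/-- The orbit closure map of an action by homeomorphisms is lower semicontinuous. -/
theorem isOpen_setOf_closure_orbit_inter_nonempty [ContinuousConstSMul G X] {U : Set X}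
    (hU : IsOpen U) : IsOpen {x | (closure (orbit G x) ∩ U).Nonempty} := by
  have : {x | (closure (orbit G x) ∩ U).Nonempty} = ⋃ g : G, (g • ·) ⁻¹' U := by
    ext x
    simp only [Set.mem_ofPred_eq, closure_inter_open_nonempty_iff hU, Set.mem_iUnion,
      Set.mem_preimage]
    constructor
    · rintro ⟨_, ⟨g, rfl⟩, hg⟩
      exact ⟨g, hg⟩
    · rintro ⟨g, hg⟩
      exact ⟨g • x, mem_orbit x g, hg⟩
  rw [this]
  exact isOpen_iUnion fun g => hU.preimage (continuous_const_smul g)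

theorem OrbitMapHCont.of_isClosed_rel [ContinuousConstSMul G X]
    (h : IsClosed {p : X × X | p.2 ∈ closure (orbit G p.1)}) : OrbitMapHCont G X := by
  intro ι _ _ _ x x₀ K hx hK
  rw [hK]
  ext y
  rw [Set.mem_ofPred_eq, hLimMem_iff]
  constructor
  · intro hy i₀ U hU
    obtain ⟨V, hVU, hV, hyV⟩ := mem_nhds_iff.1 hU
    obtain ⟨i₁, hi₁⟩ := hx _ ((isOpen_setOf_closure_orbit_inter_nonempty (G := G) hV).mem_nhds
      ⟨y, hy, hyV⟩)
    obtain ⟨i, h₀, h₁⟩ := exists_ge_ge i₀ i₁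
    exact ⟨i, h₀, (hi₁ i h₁).mono (Set.inter_subset_inter_right _ hVU)⟩
  · intro hy
    have : (x₀, y) ∈ closure {p : X × X | p.2 ∈ closure (orbit G p.1)} := by
      rw [mem_closure_iff_nhds]
      intro W hW
      obtain ⟨U, hU, V, hV, hUV⟩ := mem_nhds_prod_iff.1 hW
      obtain ⟨i₀, hi₀⟩ := hx U hU
      obtain ⟨i, hi, z, hz, hzV⟩ := hy i₀ V hV
      exact ⟨(x i, z), hUV ⟨hi₀ i hi, hzV⟩, hz⟩
    rwa [h.closure_eq] at this

theorem OrbitMapUSC.isClosed_rel [RegularSpace X] (h : OrbitMapUSC G X) :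
    IsClosed {p : X × X | p.2 ∈ closure (orbit G p.1)} := by
  rw [← isOpen_compl_iff, isOpen_iff_mem_nhds]
  rintro ⟨x, y⟩ hxy
  obtain ⟨W, hW, hWc, hWV⟩ := exists_mem_nhds_isClosed_subset
    (isClosed_closure.isOpen_compl.mem_nhds hxy)
  obtain ⟨U, hU, hUW⟩ := h x Wᶜ hWc.isOpen_compl (Set.subset_compl_comm.1 hWV)
  filter_upwards [prod_mem_nhds hU hW] with p hp hpR using hUW p.1 hp.1 hpR hp.2

theorem OrbitMapUSC.of_isClosed_rel [CompactSpace X]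
    (h : IsClosed {p : X × X | p.2 ∈ closure (orbit G p.1)}) : OrbitMapUSC G X := by
  intro x V hV hxV
  have hclosed := isClosedMap_fst_of_compactSpace _
    (h.inter (hV.isClosed_compl.preimage continuous_snd))
  refine ⟨_, hclosed.isOpen_compl.mem_nhds (x := x) ?_, fun y hy z hz => ?_⟩
  · rintro ⟨⟨_, z⟩, ⟨hz, hzV⟩, rfl⟩
    exact hzV (hxV hz)
  · by_contra hzV
    exact hy ⟨(y, z), ⟨hz, hzV⟩, rfl⟩

theorem OrbitMapUSC.continuous_orbitClosureMap [ContinuousConstSMul G X] (h : OrbitMapUSC G X) :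
    @Continuous X (ClosedsNE X) _ (vietorisTop X) (orbitClosureMap G X) := by
  refine continuous_generateFrom_iff.2 ?_
  rintro _ (⟨U, hU, rfl⟩ | ⟨U, hU, rfl⟩)
  · refine isOpen_iff_mem_nhds.2 fun x hx => ?_
    obtain ⟨N, hN, hNU⟩ := h x U hU hx
    exact Filter.mem_of_superset hN hNU
  · exact isOpen_setOf_closure_orbit_inter_nonempty hU

theorem OrbitMapUSC.of_continuous_orbitClosureMap
    (h : @Continuous X (ClosedsNE X) _ (vietorisTop X) (orbitClosureMap G X)) :
    OrbitMapUSC G X := fun _ V hV hxV =>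
  ⟨_, (continuous_generateFrom_iff.1 h _ (Or.inl ⟨V, hV, rfl⟩)).mem_nhds hxV, fun _ hy => hy⟩

end OrbitClosure

theorem stmt_2 {G X : Type u}
    [Group G] [TopologicalSpace G] [T2Space G] [ContinuousMul G]
    [TopologicalSpace X] [T2Space X] [CompactSpace X]
    [MulAction G X] [ContinuousSMul G X] :
    List.TFAE
      [OrbitMapHCont G X,
       OrbitMapUSC G X,
       @Continuous X (ClosedsNE X) _ (vietorisTop X) (orbitClosureMap G X),
       IsClosed {p : X × X | p.2 ∈ closure (orbit G p.1)}] := by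
  tfae_have 1 → 4 := OrbitMapHCont.isClosed_rel
  tfae_have 4 → 1 := OrbitMapHCont.of_isClosed_rel
  tfae_have 2 → 4 := OrbitMapUSC.isClosed_rel
  tfae_have 4 → 2 := OrbitMapUSC.of_isClosed_rel
  tfae_have 2 → 3 := OrbitMapUSC.continuous_orbitClosureMap
  tfae_have 3 → 2 := OrbitMapUSC.of_continuous_orbitClosureMap
  tfae_finish
end

section
/- Let (G,X) be a flow and let y ∈ X be such that the section R_o[y] = {x ∈ X : y ∈ cl(Gx)} is closed in X (i.e., whenever x_n is a net with y ∈ cl(Gx_n) for each n and x_n → x, then y ∈ cl(Gx)). Then cl(Gy) is a minimal set of (G,X). -/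
/-!
STATEMENT 3. For a flow (G,X) and `y ∈ X` such that the section
`R_o[y] = {x | y ∈ cl(Gx)}` is closed in `X`, the orbit closure `cl(Gy)` is minimal.
-/

universe u

open MulAction

/-- A set `K ⊆ X` is a minimal set of the flow: `cl(Gx) = K` for every `x ∈ K`. -/
def IsMinimalSet (G : Type u) {X : Type u} [Group G] [TopologicalSpace X] [MulAction G X]
    (K : Set X) : Prop :=
  ∀ x ∈ K, closure (orbit G x) = K

theorem closure_orbit_subset_of_mem {G : Type*} {X : Type*} [Group G] [TopologicalSpace X]
    [MulAction G X] [ContinuousConstSMul G X] {x y : X} (hx : x ∈ closure (orbit G y)) :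
    closure (orbit G x) ⊆ closure (orbit G y) := by
  refine closure_minimal ?_ isClosed_closure
  rintro _ ⟨g, rfl⟩
  exact map_mem_closure (continuous_const_smul g) hx fun _ hz ↦
    mem_orbit_of_mem_orbit g hz

theorem stmt_3 {G X : Type u}
    [Group G] [TopologicalSpace G] [T2Space G] [ContinuousMul G]
    [TopologicalSpace X] [T2Space X] [LocallyCompactSpace X]
    [MulAction G X] [ContinuousSMul G X]
    (horb : ∀ x : X, IsCompact (closure (orbit G x)))
    (y : X) (hy : IsClosed {x : X | y ∈ closure (orbit G x)}) :
    IsMinimalSet G (closure (orbit G y)) := by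
  intro x hx
  have hsub : closure (orbit G y) ⊆ {x : X | y ∈ closure (orbit G x)} := by
    refine closure_minimal (fun z hz ↦ ?_) hy
    rw [Set.mem_ofPred_eq, orbit_eq_iff.2 hz]
    exact subset_closure (mem_orbit_self y)
  exact (closure_orbit_subset_of_mem hx).antisymm (closure_orbit_subset_of_mem (hsub hx))
end

section
/- Let G be a compactly generated Hausdorff semitopological group with generating set Γ. Then: (1) if {g_i} is a net in G with |g_i| nondecreasing and tending to ∞ and C is a closed set with K(g_i) ⇀ C, then C is nonempty; (2) every Γ-cone C in G is a discretely thick subset of G. -/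
/-!
STATEMENT 4. For a compactly generated Hausdorff semitopological group `G` with generating
set `Γ`: (1) if `{g_i}` is a net with `|g_i|` nondecreasing and tending to `∞` and
`K(g_i) ⇀ C`, then `C ≠ ∅`; (2) every `Γ`-cone in `G` is discretely thick.
-/

universe u

open Pointwise

/-- The `Γ`-length of `g` : the least `r ≥ 1` with `g ∈ Γ^r`. -/
noncomputable def gamLen {G : Type u} [Group G] (Γ : Set G) (g : G) : ℕ :=
  sInf {r : ℕ | 0 < r ∧ g ∈ Γ ^ r}

/-- `K(g) = Γ^{|g|-1} · g`. -/
noncomputable def KSet {G : Type u} [Group G] (Γ : Set G) (g : G) : Set G :=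
  Γ ^ (gamLen Γ g - 1) * {g}

/-- `Γ` is a generating set of `G` : `Γ` is compact, `e ∈ Γ = Γ⁻¹` and `G = ⋃_{r≥1} Γ^r`. -/
def IsGenSet {G : Type u} [Group G] [TopologicalSpace G] (Γ : Set G) : Prop :=
  IsCompact Γ ∧ (1 : G) ∈ Γ ∧ Γ⁻¹ = Γ ∧ ∀ g : G, ∃ r : ℕ, 1 ≤ r ∧ g ∈ Γ ^ r

/-- `C` is a `Γ`-cone : there is a net `{g_i}` with `|g_i|` nondecreasing tending to `∞`
such that `K(g_i) ⇀ C`. -/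
def IsCone {G : Type u} [Group G] [TopologicalSpace G] (Γ : Set G) (C : Set G) : Prop :=
  ∃ (ι : Type u) (pi : Preorder ι), Nonempty ι ∧ IsDirected ι pi.le ∧
    ∃ g : ι → G,
      (∀ i j, pi.le i j → gamLen Γ (g i) ≤ gamLen Γ (g j)) ∧
      (∀ n : ℕ, ∃ i₀, ∀ i, pi.le i₀ i → n ≤ gamLen Γ (g i)) ∧
      C = {t | @HLimMem G _ ι pi (fun i => KSet Γ (g i)) t}

/-- `B` is discretely thick in `G` : for every finite `F ⊆ G` there is `t ∈ B` with `Ft ⊆ B`. -/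
def DiscretelyThick {G : Type u} [Group G] (B : Set G) : Prop :=
  ∀ F : Set G, F.Finite → ∃ t ∈ B, ∀ f ∈ F, f * t ∈ B

open Filter Topology in
/-- A cluster point of a net that eventually selects points of `Y i` belongs to the limit of
the net of sets `Y`. -/
lemma hLimMem_of_mapClusterPt {Z : Type u} [TopologicalSpace Z] {ι : Type u} [Preorder ι]
    [Nonempty ι] [IsDirected ι (· ≤ ·)] {Y : ι → Set Z} {p : ι → Z} {t : Z}
    (ht : MapClusterPt t atTop p) (hp : ∀ᶠ i in atTop, p i ∈ Y i) : HLimMem Y t := by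
  have key : ∀ U ∈ 𝓝 t, ∀ i₀, ∃ i, i₀ ≤ i ∧ p i ∈ U ∧ p i ∈ Y i := by
    intro U hU i₀
    obtain ⟨i, h₁, h₂, h₃⟩ :=
      ((ht.frequently hU).and_eventually (hp.and (eventually_ge_atTop i₀))).exists
    exact ⟨i, h₃, h₁, h₂⟩
  let κ := {x : ι × (Set Z)ᵒᵈ //
    OrderDual.ofDual x.2 ∈ 𝓝 t ∧ p x.1 ∈ OrderDual.ofDual x.2 ∧ p x.1 ∈ Y x.1}
  have mk : ∀ U ∈ 𝓝 t, ∀ i₀, ∃ k : κ, i₀ ≤ k.1.1 ∧ k.1.2 = OrderDual.toDual U := by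
    intro U hU i₀
    obtain ⟨i, hi, hiU, hiY⟩ := key U hU i₀
    exact ⟨⟨(i, OrderDual.toDual U), hU, hiU, hiY⟩, hi, rfl⟩
  refine ⟨κ, inferInstance, ?_, ⟨?_⟩, fun k => k.1.1, fun k => p k.1.1, ?_, fun k => k.2.2.2, ?_⟩
  · obtain ⟨k, -⟩ := mk Set.univ univ_mem (Classical.arbitrary ι)
    exact ⟨k⟩
  · intro a b
    obtain ⟨i₀, ha, hb⟩ := exists_ge_ge a.1.1 b.1.1
    obtain ⟨k, hk, hkU⟩ := mk _ (inter_mem a.2.1 b.2.1) i₀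
    refine ⟨k, ⟨ha.trans hk, ?_⟩, ⟨hb.trans hk, ?_⟩⟩
    · rw [hkU]
      exact Set.inter_subset_left
    · rw [hkU]
      exact Set.inter_subset_right
  · intro i
    obtain ⟨k, hk, -⟩ := mk Set.univ univ_mem i
    exact ⟨k, fun l hl => hk.trans hl.1⟩
  · intro U hU
    obtain ⟨k, -, hk⟩ := mk U hU (Classical.arbitrary ι)
    refine ⟨k, fun l hl => ?_⟩
    have hlU : OrderDual.ofDual l.1.2 ⊆ OrderDual.ofDual k.1.2 := hl.2
    rw [hk] at hlU
    exact hlU l.2.2.1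

lemma IsGenSet.mem_pow_gamLen {G : Type u} [Group G] [TopologicalSpace G] {Γ : Set G}
    (hΓ : IsGenSet Γ) (g : G) : g ∈ Γ ^ gamLen Γ g := by
  obtain ⟨r, hr, hg⟩ := hΓ.2.2.2 g
  exact (Nat.sInf_mem (s := {r : ℕ | 0 < r ∧ g ∈ Γ ^ r}) ⟨r, hr, hg⟩).2

/-- If `|g| > m`, a suffix `b` of length `m + 1` of a word for `g` satisfies
`Γ^m · b ⊆ K(g)`. -/
lemma IsGenSet.exists_suffix {G : Type u} [Group G] [TopologicalSpace G] {Γ : Set G}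
    (hΓ : IsGenSet Γ) {m : ℕ} {g : G} (hm : m + 1 ≤ gamLen Γ g) :
    ∃ b ∈ Γ ^ (m + 1), ∀ f ∈ Γ ^ m, f * b ∈ KSet Γ g := by
  obtain ⟨k, hk⟩ := Nat.exists_eq_add_of_le' hm
  have hg := hΓ.mem_pow_gamLen g
  rw [hk, pow_add] at hg
  obtain ⟨a, ha, b, hb, rfl⟩ := hg
  refine ⟨b, hb, fun f hf => ?_⟩
  have ha' : a⁻¹ ∈ Γ ^ k := by
    rw [← hΓ.2.2.1, inv_pow]
    exact Set.inv_mem_inv.2 ha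
  refine ⟨f * a⁻¹, ?_, a * b, rfl, by group⟩
  have h : gamLen Γ (a * b) - 1 = m + k := by
    dsimp only at hk
    omega
  rw [h, pow_add]
  exact Set.mul_mem_mul hf ha'

lemma IsGenSet.exists_finite_subset_pow {G : Type u} [Group G] [TopologicalSpace G] {Γ : Set G}
    (hΓ : IsGenSet Γ) {F : Set G} (hF : F.Finite) : ∃ m, F ⊆ Γ ^ m := by
  obtain ⟨m, hm⟩ := (hF.image (gamLen Γ)).bddAbove
  exact ⟨m, fun f hf => Set.pow_subset_pow_right hΓ.2.1 (hm ⟨f, hf, rfl⟩)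
    (hΓ.mem_pow_gamLen f)⟩

lemma IsCompact.set_pow {M : Type*} [Monoid M] [TopologicalSpace M] [ContinuousMul M] {s : Set M}
    (hs : IsCompact s) (n : ℕ) : IsCompact (s ^ n) := by
  induction n with
  | zero => simp [← Set.singleton_one]
  | succ n ih => simpa only [pow_succ] using ih.mul hs

open Filter Topology in
/-- The limit of a net of sets `K(g_i)` with `|g_i| → ∞` is discretely thick. -/
lemma IsGenSet.discretelyThick_hLim {G : Type u} [Group G] [TopologicalSpace G] [ContinuousMul G]
    {Γ : Set G} (hΓ : IsGenSet Γ) {ι : Type u} [Preorder ι] [Nonempty ι] [IsDirected ι (· ≤ ·)]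
    (g : ι → G) (hg : ∀ n : ℕ, ∃ i₀, ∀ i, i₀ ≤ i → n ≤ gamLen Γ (g i)) :
    DiscretelyThick {t : G | HLimMem (fun i => KSet Γ (g i)) t} := by
  intro F hF
  obtain ⟨m, hm⟩ := hΓ.exists_finite_subset_pow hF
  have hlen : ∀ᶠ i in atTop, m + 1 ≤ gamLen Γ (g i) := by
    obtain ⟨i₀, hi₀⟩ := hg (m + 1)
    filter_upwards [eventually_ge_atTop i₀] with i hi using hi₀ i hi
  have hex : ∀ i, ∃ b, m + 1 ≤ gamLen Γ (g i) →
      b ∈ Γ ^ (m + 1) ∧ ∀ f ∈ Γ ^ m, f * b ∈ KSet Γ (g i) := by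
    intro i
    by_cases h : m + 1 ≤ gamLen Γ (g i)
    · obtain ⟨b, hb⟩ := hΓ.exists_suffix h
      exact ⟨b, fun _ => hb⟩
    · exact ⟨1, fun h' => absurd h' h⟩
  choose p hp using hex
  obtain ⟨t, -, ht⟩ := (hΓ.1.set_pow (m + 1)).exists_mapClusterPt (f := atTop) (u := p)
    (le_principal_iff.2 (mem_map.2 (hlen.mono fun i hi => (hp i hi).1)))
  have hmul : ∀ f ∈ Γ ^ m, HLimMem (fun i => KSet Γ (g i)) (f * t) := fun f hf =>
    hLimMem_of_mapClusterPt (p := fun i => f * p i)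
      (ht.continuousAt_comp (continuous_const_mul f).continuousAt)
      (hlen.mono fun i hi => (hp i hi).2 f hf)
  refine ⟨t, ?_, fun f hf => hmul f (hm hf)⟩
  simpa only [one_mul, Set.mem_ofPred_eq] using hmul 1 (Set.one_mem_pow hΓ.2.1)

theorem stmt_4 {G : Type u} [Group G] [TopologicalSpace G] [T2Space G] [ContinuousMul G]
    (Γ : Set G) (hΓ : IsGenSet Γ) :
    (∀ (ι : Type u) [Preorder ι] [Nonempty ι] [IsDirected ι (· ≤ ·)],
      ∀ g : ι → G,
        (∀ i j, i ≤ j → gamLen Γ (g i) ≤ gamLen Γ (g j)) →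
        (∀ n : ℕ, ∃ i₀, ∀ i, i₀ ≤ i → n ≤ gamLen Γ (g i)) →
        {t : G | HLimMem (fun i => KSet Γ (g i)) t}.Nonempty) ∧
    (∀ C : Set G, IsCone Γ C → DiscretelyThick C) := by
  constructor
  · intro ι _ _ _ g _ hg
    obtain ⟨t, ht, -⟩ := hΓ.discretelyThick_hLim g hg ∅ Set.finite_empty
    exact ⟨t, ht⟩
  · rintro C ⟨ι, _, _, _, g, -, hg, rfl⟩
    exact hΓ.discretelyThick_hLim g hg
end

section
/- Let G be a compactly generated Hausdorff semitopological group with generating set Γ, acting jointly continuously on a zero-dimensional locally compact Hausdorff space X (orbit closures not assumed compact). Let V be an open subset of X and write V_∞ = ⋂_{g∈G} gV. Suppose V_∞ is compact. Then V_∞ is open if and only if cl(Gx) ∩ V_∞ = ∅ for every x ∈ X \ V_∞. -/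
/-!
STATEMENT 9. Let `G` be compactly generated with generating set `Γ`, acting jointly
continuously on a zero-dimensional locally compact Hausdorff space `X` (orbit closures not
assumed compact).  Let `V ⊆ X` be open and `V_∞ = ⋂_{g∈G} gV`.  If `V_∞` is compact, then
`V_∞` is open iff `cl(Gx) ∩ V_∞ = ∅` for every `x ∈ X \ V_∞`.
-/

universe u

open Pointwise MulAction

theorem mem_iInter_smul_iff {G X : Type*} [Group G] [MulAction G X] {V : Set X} {x : X} :
    x ∈ (⋂ g : G, g • V) ↔ ∀ g : G, g • x ∈ V := by
  simp only [Set.mem_iInter, Set.mem_smul_set_iff_inv_smul_mem]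
  exact ⟨fun h g => by simpa using h g⁻¹, fun h g => h g⁻¹⟩

theorem smul_mem_iInter_smul {G X : Type*} [Group G] [MulAction G X] {V : Set X} {x : X}
    (hx : x ∈ (⋂ g : G, g • V)) (h : G) : h • x ∈ (⋂ g : G, g • V) := by
  rw [mem_iInter_smul_iff] at hx ⊢
  intro g
  rw [smul_smul]
  exact hx _

/-- In a zero-dimensional locally compact space, a compact set has a compact clopen neighbourhood
inside any given open neighbourhood. -/
theorem exists_isClopen_isCompact_between {X : Type*} [TopologicalSpace X] [T2Space X]
    [LocallyCompactSpace X]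
    (hzero : TopologicalSpace.IsTopologicalBasis {s : Set X | IsClopen s})
    {K V : Set X} (hK : IsCompact K) (hV : IsOpen V) (hKV : K ⊆ V) :
    ∃ U, IsClopen U ∧ IsCompact U ∧ K ⊆ U ∧ U ⊆ V := by
  obtain ⟨L, hL, hKL, hLV⟩ := exists_compact_between hK hV hKV
  have key : ∃ U, IsClopen U ∧ K ⊆ U ∧ U ⊆ interior L := by
    refine hK.induction_on (p := fun s => ∃ U, IsClopen U ∧ s ⊆ U ∧ U ⊆ interior L)
      ⟨∅, isClopen_empty, subset_rfl, Set.empty_subset _⟩ ?_ ?_ ?_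
    · rintro s t hst ⟨U, hU, htU, hUL⟩
      exact ⟨U, hU, hst.trans htU, hUL⟩
    · rintro s t ⟨U, hU, hsU, hUL⟩ ⟨W, hW, htW, hWL⟩
      exact ⟨U ∪ W, hU.union hW, Set.union_subset_union hsU htW, Set.union_subset hUL hWL⟩
    · intro x hx
      obtain ⟨U, hU, hxU, hUL⟩ := hzero.exists_subset_of_mem_open (hKL hx) isOpen_interior
      exact ⟨U, mem_nhdsWithin_of_mem_nhds (hU.isOpen.mem_nhds hxU), U, hU, subset_rfl, hUL⟩
  obtain ⟨U, hU, hKU, hUL⟩ := key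
  exact ⟨U, hU, hL.of_isClosed_subset hU.isClosed (hUL.trans interior_subset), hKU,
    (hUL.trans interior_subset).trans hLV⟩

/-- The points which every element of `S` moves into `U`. -/
def staysIn {G X : Type*} [SMul G X] (S : Set G) (U : Set X) : Set X :=
  {x | ∀ g ∈ S, g • x ∈ U}

theorem isClosed_staysIn {G X : Type*} [SMul G X] [TopologicalSpace X] [ContinuousConstSMul G X]
    (S : Set G) {U : Set X} (hU : IsClosed U) : IsClosed (staysIn S U) := by
  have : staysIn S U = ⋂ g ∈ S, (fun x => g • x) ⁻¹' U := by
    ext x; simp [staysIn]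
  rw [this]
  exact isClosed_biInter fun g _ => hU.preimage (continuous_const_smul g)

theorem isOpen_staysIn {G X : Type*} [SMul G X] [TopologicalSpace G] [TopologicalSpace X]
    [ContinuousSMul G X] {S : Set G} (hS : IsCompact S) {U : Set X} (hU : IsOpen U) :
    IsOpen (staysIn S U) := by
  rw [isOpen_iff_eventually]
  intro x hx
  refine hS.eventually_forall_of_forall_eventually fun g hg => ?_
  have hc : Continuous fun z : X × G => z.2 • z.1 := continuous_snd.smul continuous_fst
  exact hc.continuousAt.eventually_mem (hU.mem_nhds (hx g hg))

theorem isCompact_pow {G : Type*} [Monoid G] [TopologicalSpace G] [ContinuousMul G] {S : Set G}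
    (hS : IsCompact S) (n : ℕ) : IsCompact (S ^ n) := by
  induction n with
  | zero => simp
  | succ n ih => rw [pow_succ]; exact ih.mul hS

theorem staysIn_pow_antitone {G X : Type*} [Monoid G] [SMul G X] {S : Set G} (h1 : (1 : G) ∈ S)
    (U : Set X) : Antitone fun n => staysIn (S ^ n) U :=
  fun _ _ hmn _ hx g hg => hx g (Set.pow_subset_pow_right h1 hmn hg)

/-- If the largest invariant subset of a compact clopen set `U` is not open, then some point
outside it has an orbit closure that meets it. -/
theorem exists_closure_orbit_inter_nonempty {G X : Type*}
    [Group G] [TopologicalSpace G] [ContinuousMul G]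
    [TopologicalSpace X] [T2Space X] [MulAction G X] [ContinuousSMul G X]
    {Γ : Set G} (hΓ : IsCompact Γ) (h1 : (1 : G) ∈ Γ) (hinv : Γ⁻¹ = Γ)
    (hgen : ∀ g : G, ∃ r : ℕ, g ∈ Γ ^ r)
    {U : Set X} (hU : IsClopen U) (hUc : IsCompact U) (hopen : ¬ IsOpen (⋂ g : G, g • U)) :
    ∃ y ∉ (⋂ g : G, g • U), (closure (orbit G y) ∩ (⋂ g : G, g • U)).Nonempty := by
  set K : Set X := ⋂ g : G, g • U with hK
  have hinvn (n : ℕ) {g : G} (hg : g ∈ Γ ^ n) : g⁻¹ ∈ Γ ^ n := by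
    rwa [← Set.mem_inv, ← inv_pow, hinv]
  have hmemK {x : X} (hx : ∀ n, x ∈ staysIn (Γ ^ n) U) : x ∈ K := by
    rw [hK, mem_iInter_smul_iff]
    intro g
    obtain ⟨r, hr⟩ := hgen g
    exact hx r g hr
  have hKmem {x : X} (hx : x ∈ K) (n : ℕ) : x ∈ staysIn (Γ ^ n) U :=
    fun g _ => mem_iInter_smul_iff.1 hx g
  have hanti := staysIn_pow_antitone h1 U
  have hsub (n : ℕ) : staysIn (Γ ^ n) U ⊆ U := fun x hx => by
    simpa using hx 1 (Set.one_mem_pow h1)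
  have hclosed (n : ℕ) : IsClosed (staysIn (Γ ^ n) U) := isClosed_staysIn _ hU.isClosed
  have hcpt (n : ℕ) : IsCompact (staysIn (Γ ^ n) U) := hUc.of_isClosed_subset (hclosed n) (hsub n)
  -- points about to leave `U`, from which `U` can be entered deeply in `n` steps
  let A : ℕ → Set X := fun n => (U \ staysIn Γ U) ∩ (Γ ^ n • staysIn (Γ ^ n) U)
  have hAcpt (n : ℕ) : IsCompact (A n) :=
    (hUc.diff (isOpen_staysIn hΓ hU.isOpen)).inter
      ((isCompact_pow hΓ n).smul_set (hcpt n))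
  have hAstep (n : ℕ) : A (n + 1) ⊆ A n := by
    rintro y ⟨hy, hy'⟩
    refine ⟨hy, ?_⟩
    obtain ⟨t, ht, x, hx, rfl⟩ := Set.mem_smul.1 hy'
    rw [pow_succ] at ht
    obtain ⟨s, hs, γ, hγ, rfl⟩ := Set.mem_mul.1 ht
    refine Set.mem_smul.2 ⟨s, hs, γ • x, fun g hg => ?_, smul_smul _ _ _⟩
    rw [smul_smul]
    exact hx _ (pow_succ Γ n ▸ Set.mul_mem_mul hg hγ)
  have hAne (n : ℕ) : (A n).Nonempty := by
    have hne : ∃ x ∈ staysIn (Γ ^ n) U, x ∉ K := by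
      by_contra! hcon
      refine hopen ?_
      have : K = staysIn (Γ ^ n) U := Set.Subset.antisymm (fun x hx => hKmem hx n) hcon
      rw [this]
      exact isOpen_staysIn (isCompact_pow hΓ n) hU.isOpen
    obtain ⟨x, hxn, hxK⟩ := hne
    obtain ⟨k, hnk, hk, hk'⟩ : ∃ k, n ≤ k ∧ x ∈ staysIn (Γ ^ k) U ∧
        x ∉ staysIn (Γ ^ (k + 1)) U := by
      by_contra! hcon
      have hall : ∀ k, n ≤ k → x ∈ staysIn (Γ ^ k) U := fun k hk =>
        Nat.le_induction hxn hcon k hk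
      exact hxK (hmemK fun m => hanti (le_max_right n m) (hall _ (le_max_left n m)))
    simp only [staysIn, Set.mem_ofPred_eq, not_forall] at hk'
    obtain ⟨g, hg, hgx⟩ := hk'
    rw [pow_succ'] at hg
    obtain ⟨γ, hγ, h, hh, rfl⟩ := Set.mem_mul.1 hg
    refine ⟨h • x, antitone_nat_of_succ_le hAstep hnk ⟨⟨hk h hh, fun hs => hgx ?_⟩,
      Set.smul_mem_smul hh hk⟩⟩
    rw [mul_smul]
    exact hs γ hγ
  obtain ⟨y, hy⟩ := IsCompact.nonempty_iInter_of_sequence_nonempty_isCompact_isClosed A hAstep hAne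
    (hAcpt 0) fun n => (hAcpt n).isClosed
  rw [Set.mem_iInter] at hy
  refine ⟨y, fun hyK => (hy 0).1.2 (by simpa using hKmem hyK 1), ?_⟩
  obtain ⟨z, hz⟩ := IsCompact.nonempty_iInter_of_sequence_nonempty_isCompact_isClosed
    (fun n => closure (orbit G y) ∩ staysIn (Γ ^ n) U)
    (fun n => Set.inter_subset_inter_right _ (hanti n.le_succ))
    (fun n => by
      obtain ⟨t, ht, x, hx, hxy⟩ := Set.mem_smul.1 (hy n).2
      exact ⟨x, subset_closure ⟨t⁻¹, by simp [← hxy]⟩, hx⟩)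
    ((hcpt 0).inter_left isClosed_closure) fun n => isClosed_closure.inter (hclosed n)
  rw [Set.mem_iInter] at hz
  exact ⟨z, (hz 0).1, hmemK fun n => (hz n).2⟩

theorem stmt_9 {G X : Type u}
    [Group G] [TopologicalSpace G] [T2Space G] [ContinuousMul G]
    [TopologicalSpace X] [T2Space X] [LocallyCompactSpace X]
    (hzero : TopologicalSpace.IsTopologicalBasis {s : Set X | IsClopen s})
    [MulAction G X] [ContinuousSMul G X]
    (Γ : Set G) (hΓ : IsGenSet Γ)
    (V : Set X) (hV : IsOpen V)
    (hcomp : IsCompact (⋂ g : G, g • V)) :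
    IsOpen (⋂ g : G, g • V) ↔
      ∀ x : X, x ∉ (⋂ g : G, g • V) →
        closure (orbit G x) ∩ (⋂ g : G, g • V) = ∅ := by
  have hKV : (⋂ g : G, g • V) ⊆ V := fun x hx => by simpa using mem_iInter_smul_iff.1 hx 1
  constructor
  · intro hopen x hx
    rw [← Set.disjoint_iff_inter_eq_empty]
    refine Disjoint.closure_left (Set.disjoint_left.2 ?_) hopen
    rintro _ ⟨g, rfl⟩ hg
    exact hx (by simpa using smul_mem_iInter_smul hg g⁻¹)
  · intro H
    obtain ⟨hΓc, h1, hinv, hgen⟩ := hΓ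
    obtain ⟨U, hU, hUc, hKU, hUV⟩ := exists_isClopen_isCompact_between hzero hcomp hV hKV
    have hUK : (⋂ g : G, g • U) = ⋂ g : G, g • V := by
      refine Set.Subset.antisymm (Set.iInter_mono fun g => Set.smul_set_mono hUV) fun x hx => ?_
      exact mem_iInter_smul_iff.2 fun g => hKU (smul_mem_iInter_smul hx g)
    by_contra hopen
    rw [← hUK] at hopen H
    obtain ⟨y, hy, hne⟩ := exists_closure_orbit_inter_nonempty hΓc h1 hinv
      (fun g => (hgen g).imp fun _ h => h.2) hU hUc hopen
    exact hne.ne_empty (H y hy)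
end

section
/- Let (G,X) be a distal flow with X zero-dimensional and G compactly generated. Then (G,X) is equicontinuous. -/
/-!
STATEMENT 10. Every distal flow (G,X) with `X` zero-dimensional and `G` compactly
generated is equicontinuous.
-/

universe u

open Pointwise MulAction

/-- (G,X) is distal : for `x ≠ y`, the orbit closure of `(x,y)` under the diagonal
action on `X × X` does not meet the diagonal. -/
def IsDistal (G X : Type u) [Group G] [TopologicalSpace X] [MulAction G X] : Prop :=
  ∀ x y : X, x ≠ y →
    closure (orbit G (x, y)) ∩ Set.diagonal X = ∅

/-- (G,X) is equicontinuous : for every entourage `ε` and every `x ∈ X` there is an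
entourage `δ` with `g δ[x] ⊆ ε[gx]` for all `g ∈ G`. -/
def FlowEquicontinuous (G X : Type u) [Group G] [UniformSpace X] [MulAction G X] : Prop :=
  ∀ ε ∈ uniformity X, ∀ x : X, ∃ δ ∈ uniformity X,
    ∀ g : G, ∀ y : X, (x, y) ∈ δ → (g • x, g • y) ∈ ε

/-- The orbit closure relation on pairs is symmetric in a distal flow with compact orbit
closures. -/
lemma IsDistal.mem_closure_orbit_symm {G X : Type u} [Group G] [TopologicalSpace X] [T2Space X]
    [MulAction G X] [ContinuousConstSMul G X] (hdistal : IsDistal G X)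
    (horb : ∀ x : X, IsCompact (closure (orbit G x))) {z w : X × X}
    (hw : w ∈ closure (orbit G z)) : z ∈ closure (orbit G w) := by
  let _ : TopologicalSpace (Function.End X) := Pi.topologicalSpace
  have : T2Space (Function.End X) := inferInstanceAs (T2Space (X → X))
  have hcomp (r : Function.End X) : Continuous fun f : Function.End X => f * r :=
    continuous_pi fun x => continuous_apply (r x)
  have heval (y : X × X) : Continuous fun f : Function.End X => ((f y.1, f y.2) : X × X) :=
    (continuous_apply y.1).prodMk (continuous_apply y.2)
  let σ (g : G) : Function.End X := fun x => g • x
  let T : Set (Function.End X) := Set.range σ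
  have hTE : T ⊆ closure T := subset_closure
  have horbE (y : X × X) {p : Function.End X} (hp : p ∈ closure T) :
      (p y.1, p y.2) ∈ closure (orbit G y) := by
    refine map_mem_closure (f := fun f : Function.End X => (f y.1, f y.2)) (heval y) hp ?_
    rintro _ ⟨g, rfl⟩
    exact ⟨g, rfl⟩
  have hE : IsCompact (closure T) := by
    refine IsCompact.of_isClosed_subset
      (isCompact_univ_pi fun x => horb x : IsCompact
        (Set.univ.pi fun x => closure (orbit G x))) isClosed_closure ?_
    refine closure_minimal ?_ (isClosed_set_pi fun _ _ => isClosed_closure)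
    rintro _ ⟨g, rfl⟩ x -
    exact subset_closure ⟨g, rfl⟩
  have hmulT (g : G) {q : Function.End X} (hq : q ∈ closure T) : σ g * q ∈ closure T := by
    have hc : Continuous fun q : Function.End X => σ g * q :=
      continuous_pi fun x => (continuous_apply x).const_smul g
    refine map_mem_closure hc hq ?_
    rintro _ ⟨h, rfl⟩
    exact ⟨g * h, funext fun x => mul_smul g h x⟩
  have hmul {p q : Function.End X} (hp : p ∈ closure T) (hq : q ∈ closure T) :
      p * q ∈ closure T := by
    rw [← closure_closure (s := T)]
    refine map_mem_closure (f := fun f => f * q) (hcomp q) hp ?_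
    rintro _ ⟨g, rfl⟩
    exact hmulT g hq
  obtain ⟨p, hp, rfl⟩ : w ∈ (fun f : Function.End X => ((f z.1, f z.2) : X × X)) '' closure T := by
    refine closure_minimal ?_ (hE.image (heval z)).isClosed hw
    rintro _ ⟨g, rfl⟩
    exact ⟨_, hTE ⟨g, rfl⟩, rfl⟩
  obtain ⟨_, ⟨q, hq, rfl⟩, hu⟩ := exists_idempotent_in_compact_subsemigroup hcomp
    ((fun f : Function.End X => f * p) '' closure T) ⟨_, p, hp, rfl⟩ (hE.image (hcomp p)) (by
      rintro _ ⟨a, ha, rfl⟩ _ ⟨b, hb, rfl⟩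
      exact ⟨a * p * b, hmul (hmul ha hp) hb, by simp only [mul_assoc]⟩)
  have hid (x : X) : q (p x) = x := by
    by_contra hne
    have hmem := horbE (q (p x), x) (hmul hq hp)
    have hdiag : ((q * p) (q (p x)), (q * p) x) ∈ Set.diagonal X := congrFun hu x
    exact (hdistal _ _ hne).subset ⟨hmem, hdiag⟩
  have := horbE (p z.1, p z.2) hq
  simpa only [hid] using this

/-- If the orbit closures of a flow of a compactly generated group are compact and minimal, then
the largest invariant subset of a compact clopen set is open. -/
lemma IsGenSet.isOpen_setOf_forall_smul_mem {G Y : Type u} [Group G] [TopologicalSpace G]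
    [ContinuousMul G] [TopologicalSpace Y] [MulAction G Y] [ContinuousSMul G Y]
    {Γ : Set G} (hΓ : IsGenSet Γ)
    (horb : ∀ y : Y, IsCompact (closure (orbit G y)))
    (hsymm : ∀ z w : Y, w ∈ closure (orbit G z) → z ∈ closure (orbit G w))
    {U : Set Y} (hUc : IsCompact U) (hU : IsClopen U) :
    IsOpen {y : Y | ∀ g : G, g • y ∈ U} := by
  obtain ⟨hΓc, h1, hinv, hgen⟩ := hΓ
  have hmono {m n : ℕ} (h : m ≤ n) : Γ ^ m ⊆ Γ ^ n := Set.pow_subset_pow_right h1 h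
  have hpowinv {n : ℕ} {a : G} (ha : a ∈ Γ ^ n) : a⁻¹ ∈ Γ ^ n := by
    rw [← hinv, inv_pow]
    simpa using ha
  have hpowc (n : ℕ) : IsCompact (Γ ^ n) := by
    induction n with
    | zero => simp
    | succ n ih => simpa only [pow_succ] using ih.mul hΓc
  have htube (n : ℕ) {V : Set Y} (hV : IsOpen V) : IsOpen {y : Y | ∀ a ∈ Γ ^ n, a • y ∈ V} := by
    refine isOpen_iff_eventually.2 fun y hy =>
      (hpowc n).eventually_forall_of_forall_eventually fun a ha => ?_
    have hc : Continuous fun p : Y × G => p.2 • p.1 := continuous_snd.smul continuous_fst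
    exact hc.continuousAt.eventually (hV.mem_nhds (hy a ha))
  let A (n : ℕ) : Set Y := {y | ∀ a ∈ Γ ^ n, a • y ∈ U}
  have hAclosed (n : ℕ) : IsClosed (A n) := by
    have : A n = ⋂ a ∈ Γ ^ n, (fun y => a • y) ⁻¹' U := by ext; simp [A]
    rw [this]
    exact isClosed_biInter fun a _ => hU.isClosed.preimage (continuous_const_smul a)
  let C (n : ℕ) : Set Y := {z | ∀ a ∈ Γ ^ n, a • z ∈ (A n)ᶜ}
  have hCmono : Monotone C := by
    refine monotone_nat_of_le_succ fun n z hz a ha hA => ?_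
    rw [pow_succ'] at ha
    obtain ⟨c, hc, b, hb, rfl⟩ := ha
    refine hz b hb fun d hd => ?_
    have hdc : d * c⁻¹ ∈ Γ ^ (n + 1) := by
      rw [pow_succ]
      exact Set.mul_mem_mul hd (by rw [← hinv]; simpa using hc)
    simpa [smul_smul, mul_assoc] using hA _ hdc
  obtain ⟨k, hk⟩ : ∃ k, U \ A 1 ⊆ C k := by
    refine (hUc.diff (htube 1 hU.isOpen)).elim_directed_cover C
      (fun n => htube n (hAclosed n).isOpen_compl) ?_ hCmono.directed_le
    rintro z ⟨-, hzA⟩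
    obtain ⟨γ, -, hγ⟩ : ∃ γ ∈ Γ ^ 1, γ • z ∉ U := by simpa [A] using hzA
    obtain ⟨F, hF⟩ := (horb z).elim_finite_subcover (fun g : G => (fun w : Y => g • w) ⁻¹' Uᶜ)
      (fun g => hU.isClosed.isOpen_compl.preimage (continuous_const_smul g)) (by
        intro w hw
        obtain ⟨_, hv, g, rfl⟩ := mem_closure_iff.1 (hsymm z w hw) _
          (hU.isClosed.isOpen_compl.preimage (continuous_const_smul γ)) hγ
        exact Set.mem_iUnion.2 ⟨γ * g, by simpa [mul_smul] using hv⟩)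
    choose r _ hr using hgen
    refine Set.mem_iUnion.2 ⟨F.sup r, fun a _ hA => ?_⟩
    obtain ⟨f, hf, hfU⟩ := Set.mem_iUnion₂.1 (hF (subset_closure (mem_orbit z a)))
    exact hfU (hA f (hmono (Finset.le_sup hf) (hr f)))
  have hstep (n : ℕ) : A k ⊆ A (k + n) := by
    induction n with
    | zero => exact subset_rfl
    | succ n ih =>
      intro y hy g hg
      have hyn := ih hy
      rw [← add_assoc, pow_succ'] at hg
      obtain ⟨γ, hγ, h, hh, rfl⟩ := hg
      by_contra hgU
      have hz : h • y ∈ U \ A 1 := by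
        refine ⟨hyn h hh, fun h' => hgU ?_⟩
        simpa [mul_smul] using h' γ (by simpa using hγ)
      rw [pow_add] at hh
      obtain ⟨a, ha, b, hb, rfl⟩ := hh
      refine hk hz a⁻¹ (hpowinv ha) fun c hc => ?_
      have : c * b ∈ Γ ^ (k + n) := by
        rw [pow_add]
        exact Set.mul_mem_mul hc hb
      simpa [smul_smul] using hyn _ this
  have : {y : Y | ∀ g : G, g • y ∈ U} = A k := by
    refine Set.Subset.antisymm (fun y hy a _ => hy a) fun y hy g => ?_
    obtain ⟨r, -, hr⟩ := hgen g
    exact hstep r hy g (hmono (Nat.le_add_left r k) hr)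
  rw [this]
  exact htube k hU.isOpen

/-- In a locally compact zero-dimensional uniform space, the diagonal over a compact set has
compact clopen neighbourhoods inside any entourage. -/
lemma exists_isClopen_isCompact_subset_entourage {X : Type*} [UniformSpace X] [T2Space X]
    [LocallyCompactSpace X]
    (hzero : TopologicalSpace.IsTopologicalBasis {s : Set X | IsClopen s})
    {K : Set X} (hK : IsCompact K) {ε : Set (X × X)} (hε : ε ∈ uniformity X) :
    ∃ U : Set (X × X), IsCompact U ∧ IsClopen U ∧ U ⊆ ε ∧ ∀ a ∈ K, (a, a) ∈ U := by
  have hloc (a : X) : ∃ V : Set X, IsClopen V ∧ IsCompact V ∧ a ∈ V ∧ V ×ˢ V ⊆ ε := by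
    obtain ⟨D, hD, haD⟩ := exists_compact_mem_nhds a
    have hεa : ε ∈ nhds a ×ˢ nhds a := by
      rw [← nhds_prod_eq]
      exact nhds_le_uniformity a hε
    obtain ⟨N, hN, hNε⟩ := Filter.mem_prod_same_iff.1 hεa
    obtain ⟨V, hV, haV, hVD⟩ := hzero.mem_nhds_iff.1 (Filter.inter_mem haD hN)
    exact ⟨V, hV, hD.of_isClosed_subset hV.isClosed (hVD.trans Set.inter_subset_left), haV,
      (Set.prod_mono (hVD.trans Set.inter_subset_right)
        (hVD.trans Set.inter_subset_right)).trans hNε⟩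
  choose V hVclopen hVc hV hVε using hloc
  obtain ⟨F, hF⟩ := hK.elim_finite_subcover V (fun a => (hVclopen a).isOpen)
    fun a _ => Set.mem_iUnion.2 ⟨a, hV a⟩
  refine ⟨⋃ a ∈ F, V a ×ˢ V a, F.isCompact_biUnion fun a _ => (hVc a).prod (hVc a),
    F.finite_toSet.isClopen_biUnion fun a _ => (hVclopen a).prod (hVclopen a),
    Set.iUnion₂_subset fun a _ => hVε a, fun a ha => ?_⟩
  obtain ⟨b, hb, hab⟩ := Set.mem_iUnion₂.1 (hF ha)
  exact Set.mem_iUnion₂.2 ⟨b, hb, hab, hab⟩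

theorem stmt_10 {G X : Type u}
    [Group G] [TopologicalSpace G] [T2Space G] [ContinuousMul G]
    [UniformSpace X] [T2Space X] [LocallyCompactSpace X]
    (hzero : TopologicalSpace.IsTopologicalBasis {s : Set X | IsClopen s})
    [MulAction G X] [ContinuousSMul G X]
    (horb : ∀ x : X, IsCompact (closure (orbit G x)))
    (Γ : Set G) (hΓ : IsGenSet Γ)
    (hdistal : IsDistal G X) :
    FlowEquicontinuous G X := by
  intro ε hε x
  obtain ⟨U, hUc, hU, hUε, hxU⟩ := exists_isClopen_isCompact_subset_entourage hzero (horb x) hε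
  have horb₂ (y : X × X) : IsCompact (closure (orbit G y)) := by
    refine ((horb y.1).prod (horb y.2)).of_isClosed_subset isClosed_closure ?_
    refine closure_minimal ?_ (isClosed_closure.prod isClosed_closure)
    rintro _ ⟨g, rfl⟩
    exact ⟨subset_closure (mem_orbit _ g), subset_closure (mem_orbit _ g)⟩
  have hopen := hΓ.isOpen_setOf_forall_smul_mem horb₂
    (fun _ _ h => hdistal.mem_closure_orbit_symm horb h) hUc hU
  have hnhds : {y : X | ∀ g : G, g • (x, y) ∈ U} ∈ nhds x :=
    (hopen.preimage (Continuous.prodMk_right x)).mem_nhds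
      fun g => hxU _ (subset_closure (mem_orbit x g))
  obtain ⟨δ, hδ, hsub⟩ := UniformSpace.mem_nhds_iff.1 hnhds
  exact ⟨δ, hδ, fun g y hy => hUε (hsub hy g)⟩
end

section
/- Let G be a finitely generated group with finite symmetric generating set Γ containing e, let X be a compact metric space on which G acts by homeomorphisms, and let x ∈ X. Then x is AGW-recurrent under (G,X) if and only if x is Γ-recurrent of type I. -/
/-!
STATEMENT 11. Let `G` be a finitely generated (discrete) group with finite symmetric
generating set `Γ` containing `e`, acting by homeomorphisms on a compact metric space `X`,
and let `x ∈ X`.  Then `x` is AGW-recurrent iff `x` is `Γ`-recurrent of type I.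
-/

universe u

open Pointwise MulAction

/-- `B_r = {g ∈ G | g ≠ e, |g| ≤ r}`. -/
noncomputable def BSet {G : Type u} [Group G] (Γ : Set G) (r : ℕ) : Set G :=
  {g : G | g ≠ 1 ∧ gamLen Γ g ≤ r}

/-- `Γ` is a finite generating set of the discrete group `G`. -/
def IsFinGenSet {G : Type u} [Group G] (Γ : Set G) : Prop :=
  Γ.Finite ∧ (1 : G) ∈ Γ ∧ Γ⁻¹ = Γ ∧ ∀ g : G, ∃ r : ℕ, 1 ≤ r ∧ g ∈ Γ ^ r

/-- `x` is `Γ`-recurrent of type I. -/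
def RecI {G X : Type u} [Group G] [TopologicalSpace G] [TopologicalSpace X] [MulAction G X]
    (Γ : Set G) (x : X) : Prop :=
  ∀ C : Set G, IsCone Γ C → ∀ U ∈ nhds x, ∃ c ∈ C, c • x ∈ U

/-- `C` is an AGW-cone : there is a sequence `{g_n}` with `|g_n| → ∞` such that for each
`r ≥ 1` the set `B_r ∩ K(g_n)` is independent of `n` for all large `n`, and
`C = lim_n K(g_n)` (i.e. `c ∈ C` iff `c ∈ K(g_n)` for all sufficiently large `n`). -/
def IsAGWCone {G : Type u} [Group G] (Γ : Set G) (C : Set G) : Prop :=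
  ∃ g : ℕ → G,
    (∀ n : ℕ, ∃ N : ℕ, ∀ m : ℕ, N ≤ m → n ≤ gamLen Γ (g m)) ∧
    (∀ r : ℕ, 1 ≤ r → ∃ N : ℕ, ∀ m m' : ℕ, N ≤ m → N ≤ m' →
      BSet Γ r ∩ KSet Γ (g m) = BSet Γ r ∩ KSet Γ (g m')) ∧
    C = {c : G | ∃ N : ℕ, ∀ m : ℕ, N ≤ m → c ∈ KSet Γ (g m)}

/-- `x` is AGW-recurrent : `Cx ∩ U ≠ ∅` for every AGW-cone `C` and every neighborhood `U`
of `x`. -/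
def AGWRecurrent {G X : Type u} [Group G] [TopologicalSpace X] [MulAction G X]
    (Γ : Set G) (x : X) : Prop :=
  ∀ C : Set G, IsAGWCone Γ C → ∀ U ∈ nhds x, ∃ c ∈ C, c • x ∈ U

open Filter in
theorem hLimMem_iff_frequently {Z : Type u} [TopologicalSpace Z] [DiscreteTopology Z]
    {ι : Type u} [Preorder ι] [Nonempty ι] [IsDirected ι (· ≤ ·)] {Y : ι → Set Z} {y : Z} :
    HLimMem Y y ↔ ∃ᶠ i in atTop, y ∈ Y i := by
  rw [frequently_atTop]
  constructor
  · rintro ⟨κ, pk, -, hdir, φ, p, hφ, hp, hlim⟩ i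
    obtain ⟨k₀, hk₀⟩ := hφ i
    obtain ⟨k₁, hk₁⟩ := hlim {y} (by simp)
    obtain ⟨k, h₀, h₁⟩ := hdir.directed k₀ k₁
    exact ⟨φ k, hk₀ k h₀, hk₁ k h₁ ▸ hp k⟩
  · intro h
    obtain ⟨j₀, -, hj₀⟩ := h (Classical.arbitrary ι)
    refine ⟨{i // y ∈ Y i}, inferInstance, ⟨⟨j₀, hj₀⟩⟩, ⟨fun a b => ?_⟩, Subtype.val,
      fun _ => y, fun i => ?_, fun k => k.2, fun U hU => ⟨⟨j₀, hj₀⟩, fun _ _ => mem_of_mem_nhds hU⟩⟩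
    · obtain ⟨c, hac, hbc⟩ := exists_ge_ge a.1 b.1
      obtain ⟨d, hcd, hd⟩ := h c
      exact ⟨⟨d, hd⟩, hac.trans hcd, hbc.trans hcd⟩
    · obtain ⟨d, hid, hd⟩ := h i
      exact ⟨⟨d, hd⟩, fun k hk => hid.trans hk⟩

section Length

variable {G : Type u} [Group G] {Γ : Set G}

theorem gamLen_le {g : G} {r : ℕ} (hr : 0 < r) (hg : g ∈ Γ ^ r) : gamLen Γ g ≤ r :=
  Nat.sInf_le ⟨hr, hg⟩

namespace IsFinGenSet

theorem mem_pow_gamLen (hΓ : IsFinGenSet Γ) (g : G) : g ∈ Γ ^ gamLen Γ g :=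
  (Nat.sInf_mem (s := {r : ℕ | 0 < r ∧ g ∈ Γ ^ r}) (hΓ.2.2.2 g)).2

theorem mem_pow (hΓ : IsFinGenSet Γ) {g : G} {r : ℕ} (h : gamLen Γ g ≤ r) : g ∈ Γ ^ r :=
  Set.pow_subset_pow_right hΓ.2.1 h (hΓ.mem_pow_gamLen g)

theorem finite_pow (hΓ : IsFinGenSet Γ) (r : ℕ) : (Γ ^ r).Finite := by
  induction r with
  | zero => simp
  | succ r ih => exact pow_succ Γ r ▸ ih.mul hΓ.1

theorem one_notMem_KSet (hΓ : IsFinGenSet Γ) {g : G} (hg : 2 ≤ gamLen Γ g) :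
    (1 : G) ∉ KSet Γ g := by
  rintro ⟨a, ha, b, rfl, hab⟩
  have hinv : b ∈ Γ ^ (gamLen Γ b - 1) := by
    rw [← hΓ.2.2.1, inv_pow, Set.mem_inv, hΓ.2.2.1, ← eq_inv_of_mul_eq_one_left hab]
    exact ha
  have := gamLen_le (by omega) hinv
  omega

end IsFinGenSet

end Length

section Cones

open Filter

variable {G : Type u} [Group G] [TopologicalSpace G] [DiscreteTopology G] {Γ : Set G}

/-- Every AGW-cone contains a `Γ`-cone. -/
theorem IsAGWCone.exists_isCone_subset (hΓ : IsFinGenSet Γ) {C : Set G} (hC : IsAGWCone Γ C) :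
    ∃ D, IsCone Γ D ∧ D ⊆ C := by
  obtain ⟨g, hlen, hstab, rfl⟩ := hC
  obtain ⟨φ, hφ, hmono⟩ := strictMono_subseq_of_tendsto_atTop
    (tendsto_atTop_atTop.2 hlen)
  refine ⟨_, ⟨ULift.{u} ℕ, inferInstance, inferInstance, inferInstance, fun i => g (φ i.down),
    fun i j hij => hmono.monotone hij, fun n => ?_, rfl⟩, ?_⟩
  · obtain ⟨N, hN⟩ := hlen n
    exact ⟨⟨N⟩, fun i hi => hN _ ((show N ≤ i.down from hi).trans hφ.le_apply)⟩
  · intro t ht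
    rw [Set.mem_ofPred_eq, hLimMem_iff_frequently, frequently_atTop] at ht
    obtain ⟨N, hN⟩ := hstab (gamLen Γ t + 1) (by omega)
    obtain ⟨M, hM⟩ := hlen 2
    obtain ⟨i, hi, hti⟩ := ht ⟨max N M⟩
    have hi' : max N M ≤ φ i.down := (show max N M ≤ i.down from hi).trans hφ.le_apply
    have ht1 : t ≠ 1 := by
      rintro rfl
      exact hΓ.one_notMem_KSet (hM _ ((le_max_right _ _).trans hi')) hti
    refine ⟨N, fun m hm => ?_⟩
    have hmem : t ∈ BSet Γ (gamLen Γ t + 1) ∩ KSet Γ (g (φ i.down)) :=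
      ⟨⟨ht1, Nat.le_succ _⟩, hti⟩
    exact (hN _ m ((le_max_left _ _).trans hi') hm ▸ hmem).2

/-- Every `Γ`-cone contains an AGW-cone. -/
theorem IsCone.exists_isAGWCone_subset (hΓ : IsFinGenSet Γ) {C : Set G} (hC : IsCone Γ C) :
    ∃ D, IsAGWCone Γ D ∧ D ⊆ C := by
  obtain ⟨ι, pi, hne, hdir, g, -, hlen, rfl⟩ := hC
  let F : Ultrafilter ι := Ultrafilter.of atTop
  have hF : (F : Filter ι) ≤ atTop := Ultrafilter.of_le _
  let L : Set G := {c | ∀ᶠ i in F, c ∈ KSet Γ (g i)}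
  have hagree (c : G) : ∀ᶠ i in F, (c ∈ KSet Γ (g i) ↔ c ∈ L) := by
    by_cases hc : c ∈ L
    · filter_upwards [show ∀ᶠ i in F, c ∈ KSet Γ (g i) from hc] with i hi
      exact iff_of_true hi hc
    · filter_upwards [Ultrafilter.eventually_not.2 hc] with i hi
      exact iff_of_false hi hc
  have hseq (n : ℕ) : ∃ i, n ≤ gamLen Γ (g i) ∧ ∀ c ∈ Γ ^ n, (c ∈ KSet Γ (g i) ↔ c ∈ L) :=
    (((eventually_atTop.2 (hlen n)).filter_mono hF).and
      ((eventually_all_finite (hΓ.finite_pow n)).2 fun c _ => hagree c)).exists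
  choose s hs hsL using hseq
  have hmem {c : G} {m : ℕ} (h : gamLen Γ c ≤ m) : c ∈ KSet Γ (g (s m)) ↔ c ∈ L :=
    hsL m c (hΓ.mem_pow h)
  refine ⟨_, ⟨fun n => g (s n), fun n => ⟨n, fun m hm => hm.trans (hs m)⟩,
    fun r _ => ⟨r, fun m m' hm hm' => ?_⟩, rfl⟩, ?_⟩
  · ext c
    refine and_congr_right fun hc => ?_
    exact (hmem (hc.2.trans hm)).trans (hmem (hc.2.trans hm')).symm
  · rintro c ⟨N, hN⟩
    have hcL : c ∈ L := (hmem (le_max_right N _)).1 (hN _ (le_max_left N _))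
    rw [Set.mem_ofPred_eq, hLimMem_iff_frequently]
    exact (Eventually.frequently hcL).filter_mono hF

end Cones

theorem stmt_11 {G X : Type u}
    [Group G] [TopologicalSpace G] [DiscreteTopology G]
    [MetricSpace X] [CompactSpace X]
    [MulAction G X] (hc : ∀ g : G, Continuous fun y : X => g • y)
    (Γ : Set G) (hΓ : IsFinGenSet Γ) (x : X) :
    AGWRecurrent Γ x ↔ RecI Γ x := by
  constructor
  · intro h C hC U hU
    obtain ⟨D, hD, hDC⟩ := hC.exists_isAGWCone_subset hΓ
    obtain ⟨c, hc, hcU⟩ := h D hD U hU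
    exact ⟨c, hDC hc, hcU⟩
  · intro h C hC U hU
    obtain ⟨D, hD, hDC⟩ := hC.exists_isCone_subset hΓ
    obtain ⟨c, hc, hcU⟩ := h D hD U hU
    exact ⟨c, hDC hc, hcU⟩
end

section
/- Let f: X → X be a homeomorphism of a locally compact Hausdorff space X such that cl({f^n x : n ∈ ℤ}) is compact for every x ∈ X, regarded as a ℤ-flow. Then a point x ∈ X is recurrent of type I if and only if there exist a net {i_n} in ℤ with i_n → +∞ and a net {j_n} in ℤ with j_n → −∞ such that f^{i_n}x → x and f^{j_n}x → x. -/
/-!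
STATEMENT 13. Let `f : X → X` be a homeomorphism of a locally compact Hausdorff space `X`
with compact orbit closures, regarded as a `ℤ`-flow.  Then `x` is recurrent of type I iff
there are nets `{i_n}` in `ℤ` with `i_n → +∞` and `{j_n}` with `j_n → −∞` such that
`f^{i_n} x → x` and `f^{j_n} x → x`.
-/

universe u

open Pointwise

/-- The iterate `f^n` (for `n : ℤ`) of a homeomorphism `f`. -/
def fpow {X : Type u} [TopologicalSpace X] (f : X ≃ₜ X) (n : ℤ) : X → X :=
  ⇑(f.toEquiv ^ n)

/-- `r`-fold sumset `Γ^{(r)}` of a subset of `ℤ` (with `Γ^{(0)} = {0}`). -/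
def sumPow (Γ : Set ℤ) : ℕ → Set ℤ
  | 0 => ({0} : Set ℤ)
  | n + 1 => sumPow Γ n + Γ

/-- `Γ` is a generating set of `ℤ` : a finite symmetric set containing `0` that
generates `ℤ`. -/
def IsZGenSet (Γ : Set ℤ) : Prop :=
  Γ.Finite ∧ (0 : ℤ) ∈ Γ ∧ -Γ = Γ ∧ ∀ g : ℤ, ∃ r : ℕ, 1 ≤ r ∧ g ∈ sumPow Γ r

/-- The `Γ`-length of `g ∈ ℤ` : the least `r ≥ 1` with `g ∈ Γ^{(r)}`. -/
noncomputable def zLen (Γ : Set ℤ) (g : ℤ) : ℕ :=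
  sInf {r : ℕ | 0 < r ∧ g ∈ sumPow Γ r}

/-- `K(g) = Γ^{(|g|−1)} + g`. -/
noncomputable def zKSet (Γ : Set ℤ) (g : ℤ) : Set ℤ :=
  sumPow Γ (zLen Γ g - 1) + ({g} : Set ℤ)

/-- `HLimMem Y y` (in `ℤ`, discrete) : there are a subnet of the net of sets `{Y i}` and
points of the corresponding sets converging to (i.e. eventually equal to) `y`. -/
def HLimMemZ {ι : Type} [Preorder ι] (Y : ι → Set ℤ) (y : ℤ) : Prop :=
  ∃ (κ : Type) (pk : Preorder κ),
    Nonempty κ ∧ IsDirected κ pk.le ∧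
    ∃ (φ : κ → ι) (p : κ → ℤ),
      (∀ i, ∃ k₀, ∀ k, pk.le k₀ k → i ≤ φ k) ∧
      (∀ k, p k ∈ Y (φ k)) ∧
      (∀ U ∈ nhds y, ∃ k₀, ∀ k, pk.le k₀ k → p k ∈ U)

/-- `C` is a `Γ`-cone in `ℤ`. -/
def IsZCone (Γ : Set ℤ) (C : Set ℤ) : Prop :=
  ∃ (ι : Type) (pi : Preorder ι), Nonempty ι ∧ IsDirected ι pi.le ∧
    ∃ g : ι → ℤ,
      (∀ i j, pi.le i j → zLen Γ (g i) ≤ zLen Γ (g j)) ∧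
      (∀ n : ℕ, ∃ i₀, ∀ i, pi.le i₀ i → n ≤ zLen Γ (g i)) ∧
      C = {t | @HLimMemZ ι pi (fun i => zKSet Γ (g i)) t}

/-- `x` is `Γ`-recurrent of type I for the `ℤ`-flow generated by `f`. -/
def ZRecI {X : Type u} [TopologicalSpace X] (f : X ≃ₜ X) (Γ : Set ℤ) (x : X) : Prop :=
  ∀ C : Set ℤ, IsZCone Γ C → ∀ U ∈ nhds x, ∃ c ∈ C, fpow f c x ∈ U

/-- `x` is recurrent of type I : `Γ`-recurrent of type I for every generating set `Γ`
of `ℤ`. -/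
def ZRecurrentI {X : Type u} [TopologicalSpace X] (f : X ≃ₜ X) (x : X) : Prop :=
  ∀ Γ : Set ℤ, IsZGenSet Γ → ZRecI f Γ x

lemma neg_mem_sumPow {Γ : Set ℤ} (hΓ : -Γ = Γ) {r : ℕ} {a : ℤ} (ha : a ∈ sumPow Γ r) :
    -a ∈ sumPow Γ r := by
  induction r generalizing a with
  | zero => simpa [sumPow] using ha
  | succ r ih =>
    obtain ⟨b, hb, c, hc, rfl⟩ := Set.mem_add.1 ha
    refine Set.mem_add.2 ⟨-b, ih hb, -c, ?_, by ring⟩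
    rw [← hΓ]
    simpa using hc

lemma sumPow_mono {Γ : Set ℤ} (h0 : (0 : ℤ) ∈ Γ) : Monotone (sumPow Γ) :=
  monotone_nat_of_le_succ fun _ a ha => Set.mem_add.2 ⟨a, ha, 0, h0, add_zero a⟩

lemma abs_le_of_mem_sumPow {Γ : Set ℤ} {m : ℤ} (hm : ∀ a ∈ Γ, |a| ≤ m) {r : ℕ} {a : ℤ}
    (ha : a ∈ sumPow Γ r) : |a| ≤ m * r := by
  induction r generalizing a with
  | zero => simp_all [sumPow]
  | succ r ih =>
    obtain ⟨b, hb, c, hc, rfl⟩ := Set.mem_add.1 ha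
    have h₁ := ih hb
    have h₂ := hm c hc
    have h₃ := abs_add_le b c
    push_cast
    linarith

lemma mul_add_mem_sumPow {Γ : Set ℤ} {m : ℤ} (hm : m ∈ Γ) {r : ℕ} {a : ℤ}
    (ha : a ∈ sumPow Γ r) (q : ℕ) : q * m + a ∈ sumPow Γ (q + r) := by
  induction q with
  | zero => simpa using ha
  | succ q ih =>
    rw [Nat.succ_add]
    exact Set.mem_add.2 ⟨_, ih, m, hm, by push_cast; ring⟩

lemma IsZGenSet.zLen_spec {Γ : Set ℤ} (h : IsZGenSet Γ) (g : ℤ) :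
    0 < zLen Γ g ∧ g ∈ sumPow Γ (zLen Γ g) :=
  Nat.sInf_mem (s := {r : ℕ | 0 < r ∧ g ∈ sumPow Γ r}) (h.2.2.2 g)

lemma zLen_le {Γ : Set ℤ} {r : ℕ} {g : ℤ} (hr : 0 < r) (hg : g ∈ sumPow Γ r) :
    zLen Γ g ≤ r :=
  Nat.sInf_le ⟨hr, hg⟩

lemma zLen_neg {Γ : Set ℤ} (hΓ : -Γ = Γ) (g : ℤ) : zLen Γ (-g) = zLen Γ g := by
  unfold zLen
  congr 1
  ext r
  exact and_congr_right fun _ =>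
    ⟨fun h => by simpa using neg_mem_sumPow hΓ h, neg_mem_sumPow hΓ⟩

lemma mem_zKSet {Γ : Set ℤ} {g t : ℤ} :
    t ∈ zKSet Γ g ↔ t - g ∈ sumPow Γ (zLen Γ g - 1) := by
  simp [zKSet, sub_eq_add_neg]

lemma neg_mem_zKSet {Γ : Set ℤ} (hΓ : -Γ = Γ) {g t : ℤ} (ht : t ∈ zKSet Γ g) :
    -t ∈ zKSet Γ (-g) := by
  rw [mem_zKSet] at ht ⊢
  rw [zLen_neg hΓ, ← neg_sub']
  exact neg_mem_sumPow hΓ ht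

/-- A generating set has a positive largest element `m`, and up to a bounded error the length
of `g` is `|g| / m`. -/
lemma IsZGenSet.exists_length_bounds {Γ : Set ℤ} (h : IsZGenSet Γ) :
    ∃ m : ℤ, 0 < m ∧ ∃ c : ℕ, 0 < c ∧ (∀ a ∈ Γ, |a| ≤ m) ∧
      ∀ g : ℤ, 0 ≤ g → ∃ q : ℕ, q * m ≤ g ∧ g ∈ sumPow Γ (q + c) := by
  obtain ⟨hfin, h0, hneg, hgen⟩ := h
  obtain ⟨m, hmΓ, hmax⟩ := Set.exists_max_image Γ id hfin ⟨0, h0⟩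
  have habs : ∀ a ∈ Γ, |a| ≤ m := fun a ha => by
    have hna : -a ∈ Γ := by rw [← hneg]; simpa using ha
    exact abs_le'.2 ⟨hmax a ha, hmax _ hna⟩
  have hm : 0 < m := by
    by_contra! hle
    obtain ⟨r, -, hr⟩ := hgen 1
    have h₁ := abs_le_of_mem_sumPow habs hr
    have h₂ : m * r ≤ 0 := mul_nonpos_of_nonpos_of_nonneg hle (by positivity)
    norm_num at h₁
    linarith
  choose len _ hlen using hgen
  obtain ⟨c, hc⟩ := ((Set.finite_Ico 0 m).image len).bddAbove
  refine ⟨m, hm, c + 1, c.succ_pos, habs, fun g hg => ⟨(g / m).toNat, ?_, ?_⟩⟩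
  · rw [Int.toNat_of_nonneg (Int.ediv_nonneg hg hm.le)]
    exact Int.ediv_mul_le g hm.ne'
  · have hs : g % m ∈ sumPow Γ (c + 1) :=
      sumPow_mono h0 ((hc ⟨_, ⟨Int.emod_nonneg g hm.ne', Int.emod_lt_of_pos g hm⟩, rfl⟩).trans
        c.le_succ) (hlen _)
    have := mul_add_mem_sumPow hmΓ hs (g / m).toNat
    rwa [Int.toNat_of_nonneg (Int.ediv_nonneg hg hm.le), Int.ediv_mul_add_emod] at this

lemma IsZGenSet.exists_forall_mem_zKSet {Γ : Set ℤ} (h : IsZGenSet Γ) :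
    ∃ T : ℤ, ∀ t, T ≤ t → ∃ n : ℕ, ∀ g : ℤ, n ≤ zLen Γ g →
      (0 ≤ g → t ∈ zKSet Γ g) ∧ (g ≤ 0 → -t ∈ zKSet Γ g) := by
  obtain ⟨m, hm, c, hc, habs, hrep⟩ := h.exists_length_bounds
  have key : ∀ t : ℤ, m * (c + 1) ≤ t → ∀ g : ℤ, 0 ≤ g → t.toNat + c + 1 ≤ zLen Γ g →
      t ∈ zKSet Γ g := by
    intro t ht g hg hlen
    have htg : t ≤ g := by
      by_contra! hlt
      obtain ⟨q, hq, hgq⟩ := hrep g hg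
      have h₁ := zLen_le (by omega) hgq
      have h₂ : (q : ℤ) ≤ q * m := le_mul_of_one_le_right (by positivity) hm
      omega
    obtain ⟨q, hq, hgq⟩ := hrep (g - t) (by linarith)
    have hup := (le_abs_self g).trans (abs_le_of_mem_sumPow habs (h.zLen_spec g).2)
    have hqc : q + c + 1 ≤ zLen Γ g := by
      have : m * (q + c + 1) ≤ m * zLen Γ g := by linarith
      exact_mod_cast le_of_mul_le_mul_left this hm
    rw [mem_zKSet, ← neg_sub]
    exact neg_mem_sumPow h.2.2.1 (sumPow_mono h.2.1 (by omega) hgq)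
  refine ⟨m * (c + 1), fun t ht => ⟨t.toNat + c + 1, fun g hlen =>
    ⟨fun hg => key t ht g hg hlen, fun hg => ?_⟩⟩⟩
  have := key t ht (-g) (by linarith) (by rwa [zLen_neg h.2.2.1])
  simpa using neg_mem_zKSet h.2.2.1 this

lemma hLimMemZ_of_cofinal {ι : Type} [Preorder ι] [Nonempty ι] [IsDirected ι (· ≤ ·)]
    {Y : ι → Set ℤ} {y : ℤ} (h : ∀ i, ∃ j, i ≤ j ∧ y ∈ Y j) : HLimMemZ Y y := by
  refine ⟨{j // y ∈ Y j}, inferInstance, ?_, ⟨fun a b => ?_⟩, Subtype.val, fun _ => y, ?_,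
    fun k => k.2, ?_⟩
  · obtain ⟨j, -, hj⟩ := h (Classical.arbitrary ι)
    exact ⟨⟨j, hj⟩⟩
  · obtain ⟨i, hai, hbi⟩ := exists_ge_ge a.1 b.1
    obtain ⟨j, hij, hj⟩ := h i
    exact ⟨⟨j, hj⟩, hai.trans hij, hbi.trans hij⟩
  · intro i
    obtain ⟨j, hij, hj⟩ := h i
    exact ⟨⟨j, hj⟩, fun k hk => hij.trans hk⟩
  · obtain ⟨j, -, hj⟩ := h (Classical.arbitrary ι)
    exact fun U hU => ⟨⟨j, hj⟩, fun _ _ => mem_of_mem_nhds hU⟩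

lemma HLimMemZ.exists_mem {ι : Type} [Preorder ι] {Y : ι → Set ℤ} {y : ℤ}
    (h : HLimMemZ Y y) : ∃ i, y ∈ Y i := by
  obtain ⟨κ, pk, -, -, φ, p, -, hp, hlim⟩ := h
  obtain ⟨k, hk⟩ := hlim {y} (by simp)
  have hky : p k = y := hk k (pk.le_refl k)
  exact ⟨φ k, hky ▸ hp k⟩

/-- Every cone of `ℤ` contains a half-line. -/
lemma IsZCone.exists_halfLine {Γ C : Set ℤ} (h : IsZGenSet Γ) (hC : IsZCone Γ C) :
    ∃ T : ℤ, (∀ t, T ≤ t → t ∈ C) ∨ ∀ t, T ≤ t → -t ∈ C := by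
  obtain ⟨ι, pi, hne, hdir, g, -, htop, rfl⟩ := hC
  obtain ⟨T, hT⟩ := h.exists_forall_mem_zKSet
  refine ⟨T, ?_⟩
  by_cases hcof : ∀ i, ∃ j, i ≤ j ∧ 0 ≤ g j
  · refine Or.inl fun t ht => Set.mem_ofPred.2 (hLimMemZ_of_cofinal fun i => ?_)
    obtain ⟨n, hn⟩ := hT t ht
    obtain ⟨i₀, hi₀⟩ := htop n
    obtain ⟨k, hik, hk⟩ := exists_ge_ge i i₀
    obtain ⟨j, hkj, hj⟩ := hcof k
    exact ⟨j, hik.trans hkj, (hn _ (hi₀ j (hk.trans hkj))).1 hj⟩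
  · push Not at hcof
    obtain ⟨i₁, hi₁⟩ := hcof
    refine Or.inr fun t ht => Set.mem_ofPred.2 (hLimMemZ_of_cofinal fun i => ?_)
    obtain ⟨n, hn⟩ := hT t ht
    obtain ⟨i₀, hi₀⟩ := htop n
    obtain ⟨k, hik, hk⟩ := exists_ge_ge i i₀
    obtain ⟨j, hkj, hj⟩ := exists_ge_ge k i₁
    exact ⟨j, hik.trans hkj, (hn _ (hi₀ j (hk.trans hkj))).2 (hi₁ j hj).le⟩

lemma sumPow_Icc {N : ℤ} (hN : 0 ≤ N) (r : ℕ) :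
    sumPow (Set.Icc (-N) N) r = Set.Icc (-(N * r)) (N * r) := by
  induction r with
  | zero => simp [sumPow]
  | succ r ih =>
    have hr : 0 ≤ N * (r : ℤ) := by positivity
    have hrN : N * ((r + 1 : ℕ) : ℤ) = N * r + N := by push_cast; ring
    rw [sumPow, ih, hrN]
    ext a
    simp only [Set.mem_add, Set.mem_Icc]
    constructor
    · rintro ⟨b, hb, c, hc, rfl⟩
      constructor <;> linarith
    · rintro ⟨h₁, h₂⟩
      refine ⟨max (-(N * r)) (min a (N * r)), ?_, a - max (-(N * r)) (min a (N * r)), ?_, ?_⟩ <;>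
        omega

lemma isZGenSet_Icc {N : ℤ} (hN : 0 < N) : IsZGenSet (Set.Icc (-N) N) := by
  refine ⟨Set.finite_Icc _ _, ⟨by linarith, hN.le⟩, by simp, fun g =>
    ⟨g.natAbs + 1, by omega, ?_⟩⟩
  rw [sumPow_Icc hN.le]
  have h : |g| ≤ N * ((g.natAbs + 1 : ℕ) : ℤ) := by
    push_cast
    nlinarith [abs_nonneg g]
  exact abs_le.1 h

lemma zLen_Icc_mul {N : ℤ} (hN : 0 < N) (k : ℕ) :
    zLen (Set.Icc (-N) N) (N * (k + 1 : ℕ)) = k + 1 := by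
  have hpos : 0 ≤ N * ((k + 1 : ℕ) : ℤ) := by positivity
  refine le_antisymm (zLen_le k.succ_pos ?_) ?_
  · rw [sumPow_Icc hN.le]
    exact ⟨by linarith, le_rfl⟩
  · have h := ((isZGenSet_Icc hN).zLen_spec (N * (k + 1 : ℕ))).2
    rw [sumPow_Icc hN.le] at h
    exact_mod_cast le_of_mul_le_mul_left h.2 hN

lemma exists_isZCone_subset_Ici {N : ℤ} (hN : 0 < N) :
    ∃ C, IsZCone (Set.Icc (-N) N) C ∧ C ⊆ Set.Ici N := by
  refine ⟨_, ⟨ℕ, inferInstance, inferInstance, inferInstance, fun k => N * (k + 1 : ℕ), ?_, ?_,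
    rfl⟩, fun t ht => ?_⟩
  · intro i j hij
    simp only [zLen_Icc_mul hN]
    exact Nat.succ_le_succ hij
  · refine fun n => ⟨n, fun i hi => ?_⟩
    simp only [zLen_Icc_mul hN]
    exact le_trans hi i.le_succ
  · obtain ⟨k, hk⟩ := HLimMemZ.exists_mem (Set.mem_ofPred.1 ht)
    rw [mem_zKSet, zLen_Icc_mul hN, sumPow_Icc hN.le] at hk
    have := hk.1
    push_cast at this
    rw [Set.mem_Ici]
    linarith

lemma exists_isZCone_subset_Iic {N : ℤ} (hN : 0 < N) :
    ∃ C, IsZCone (Set.Icc (-N) N) C ∧ C ⊆ Set.Iic (-N) := by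
  have hlen (k : ℕ) : zLen (Set.Icc (-N) N) (-(N * (k + 1 : ℕ))) = k + 1 := by
    rw [zLen_neg (isZGenSet_Icc hN).2.2.1, zLen_Icc_mul hN]
  refine ⟨_, ⟨ℕ, inferInstance, inferInstance, inferInstance, fun k => -(N * (k + 1 : ℕ)), ?_, ?_,
    rfl⟩, fun t ht => ?_⟩
  · intro i j hij
    simp only [hlen]
    exact Nat.succ_le_succ hij
  · refine fun n => ⟨n, fun i hi => ?_⟩
    simp only [hlen]
    exact le_trans hi i.le_succ
  · obtain ⟨k, hk⟩ := HLimMemZ.exists_mem (Set.mem_ofPred.1 ht)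
    rw [mem_zKSet, hlen, sumPow_Icc hN.le] at hk
    have := hk.2
    push_cast at this
    rw [Set.mem_Iic]
    linarith

/-- If `F` takes values arbitrarily near `x` at integers `c` satisfying `P M c` for every `M`,
then some net of such integers has values converging to `x`. -/
lemma exists_net_of_frequently {X : Type u} [TopologicalSpace X] {F : ℤ → X} {x : X}
    {P : ℤ → ℤ → Prop} (hP : ∀ M M' c, M ≤ M' → P M' c → P M c)
    (h : ∀ M : ℤ, ∀ U ∈ nhds x, ∃ c, P M c ∧ F c ∈ U) :
    ∃ (ι : Type u) (pi : Preorder ι), Nonempty ι ∧ IsDirected ι pi.le ∧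
      ∃ i : ι → ℤ, (∀ M : ℤ, ∃ n₀, ∀ n, pi.le n₀ n → P M (i n)) ∧
        (∀ U ∈ nhds x, ∃ n₀, ∀ n, pi.le n₀ n → F (i n) ∈ U) := by
  choose! c hcP hcU using h
  refine ⟨ℤ × {U : Set X // U ∈ nhds x}ᵒᵈ, inferInstance,
    ⟨(0, OrderDual.toDual ⟨Set.univ, Filter.univ_mem⟩)⟩, ⟨fun a b =>
      ⟨(max a.1 b.1, OrderDual.toDual ⟨(OrderDual.ofDual a.2).1 ∩ (OrderDual.ofDual b.2).1,
        Filter.inter_mem (OrderDual.ofDual a.2).2 (OrderDual.ofDual b.2).2⟩),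
        ⟨le_max_left _ _, Set.inter_subset_left⟩, ⟨le_max_right _ _, Set.inter_subset_right⟩⟩⟩,
    fun n => c n.1 (OrderDual.ofDual n.2).1, fun M => ?_, fun U hU => ?_⟩
  · exact ⟨(M, OrderDual.toDual ⟨Set.univ, Filter.univ_mem⟩), fun n hn =>
      hP _ _ _ hn.1 (hcP _ _ (OrderDual.ofDual n.2).2)⟩
  · exact ⟨(0, OrderDual.toDual ⟨U, hU⟩), fun n hn =>
      hn.2 (hcU n.1 _ (OrderDual.ofDual n.2).2)⟩

theorem stmt_13 {X : Type u} [TopologicalSpace X] [T2Space X] [LocallyCompactSpace X]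
    (f : X ≃ₜ X)
    (horb : ∀ x : X, IsCompact (closure (Set.range fun n : ℤ => fpow f n x)))
    (x : X) :
    ZRecurrentI f x ↔
      ((∃ (ι : Type u) (pi : Preorder ι), Nonempty ι ∧ IsDirected ι pi.le ∧
          ∃ i : ι → ℤ,
            (∀ M : ℤ, ∃ n₀, ∀ n, pi.le n₀ n → M ≤ i n) ∧
            (∀ U ∈ nhds x, ∃ n₀, ∀ n, pi.le n₀ n → fpow f (i n) x ∈ U)) ∧
       (∃ (ι : Type u) (pi : Preorder ι), Nonempty ι ∧ IsDirected ι pi.le ∧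
          ∃ j : ι → ℤ,
            (∀ M : ℤ, ∃ n₀, ∀ n, pi.le n₀ n → j n ≤ M) ∧
            (∀ U ∈ nhds x, ∃ n₀, ∀ n, pi.le n₀ n → fpow f (j n) x ∈ U))) := by
  constructor
  · intro hrec
    constructor
    · refine exists_net_of_frequently (F := fun n => fpow f n x) (P := fun M c => M ≤ c)
        (fun _ _ _ => le_trans) fun M U hU => ?_
      have hN : 0 < max M 1 := by positivity
      obtain ⟨C, hC, hsub⟩ := exists_isZCone_subset_Ici hN
      obtain ⟨c, hc, hcU⟩ := hrec _ (isZGenSet_Icc hN) C hC U hU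
      exact ⟨c, (le_max_left _ _).trans (hsub hc), hcU⟩
    · have hneg : ∀ M : ℤ, ∀ U ∈ nhds x, ∃ c, c ≤ -M ∧ fpow f c x ∈ U := fun M U hU => by
        have hN : 0 < max M 1 := by positivity
        obtain ⟨C, hC, hsub⟩ := exists_isZCone_subset_Iic hN
        obtain ⟨c, hc, hcU⟩ := hrec _ (isZGenSet_Icc hN) C hC U hU
        exact ⟨c, (hsub hc).trans (neg_le_neg (le_max_left _ _)), hcU⟩
      obtain ⟨ι, pi, hne, hdir, j, hj, hlim⟩ := exists_net_of_frequently
        (F := fun n => fpow f n x) (P := fun M c => c ≤ -M)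
        (fun _ _ _ hM hc => hc.trans (neg_le_neg hM)) hneg
      exact ⟨ι, pi, hne, hdir, j, fun M => by simpa using hj (-M), hlim⟩
  · rintro ⟨⟨ι, pi, -, hdir, i, hi, hilim⟩, κ, pk, -, hdir', j, hj, hjlim⟩ Γ hΓ C hC U hU
    obtain ⟨T, hT | hT⟩ := hC.exists_halfLine hΓ
    · obtain ⟨a, ha⟩ := hi T
      obtain ⟨b, hb⟩ := hilim U hU
      obtain ⟨n, han, hbn⟩ := exists_ge_ge a b
      exact ⟨i n, hT _ (ha n han), hb n hbn⟩
    · obtain ⟨a, ha⟩ := hj (-T)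
      obtain ⟨b, hb⟩ := hjlim U hU
      obtain ⟨n, han, hbn⟩ := exists_ge_ge a b
      exact ⟨j n, by simpa using hT (-j n) (le_neg_of_le_neg (ha n han)), hb n hbn⟩
end

section
/- Let (G,X) be a flow with G finitely generated and X zero-dimensional compact. If every point of X is regularly almost periodic, then (G,X) is regularly almost periodic. -/
/-!
STATEMENT 14. Let (G,X) be a flow with `G` a finitely generated (discrete) group and `X`
zero-dimensional compact.  If every point is regularly almost periodic, then (G,X) is
regularly almost periodic.
-/

universe u

open Pointwise

/-- `A` is syndetic in the discrete group `G` : `G = FA` for some finite `F ⊆ G`. -/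
def DSyndetic {G : Type u} [Group G] (A : Set G) : Prop :=
  ∃ F : Set G, F.Finite ∧ F * A = Set.univ

/-- `x` is a regularly almost periodic point : every `N_G(x,U)` contains a syndetic
subgroup of `G`. -/
def IsRegAPpt (G : Type u) {X : Type u} [Group G] [TopologicalSpace X]
    [MulAction G X] (x : X) : Prop :=
  ∀ U ∈ nhds x, ∃ H : Subgroup G, DSyndetic (H : Set G) ∧ ∀ h ∈ H, h • x ∈ U

/-- (G,X) is regularly almost periodic : for every entourage `α` there is a syndetic
subgroup `A` of `G` with `Ax ⊆ α[x]` for all `x ∈ X`. -/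
def RegAPFlow (G X : Type u) [Group G] [UniformSpace X] [MulAction G X] : Prop :=
  ∀ α ∈ uniformity X, ∃ H : Subgroup G, DSyndetic (H : Set G) ∧
    ∀ x : X, ∀ h ∈ H, (x, h • x) ∈ α

theorem Subgroup.finiteIndex_of_dSyndetic {G : Type u} [Group G] {H : Subgroup G}
    (h : DSyndetic (H : Set G)) : H.FiniteIndex := by
  obtain ⟨F, hF, hFH⟩ := h
  have hcover : (QuotientGroup.mk : G → G ⧸ H) '' F = Set.univ := by
    refine Set.eq_univ_of_forall fun q => ?_
    obtain ⟨g, rfl⟩ := QuotientGroup.mk_surjective q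
    obtain ⟨f, hf, a, ha, rfl⟩ : g ∈ F * (H : Set G) := hFH ▸ Set.mem_univ g
    exact ⟨f, hf, (QuotientGroup.mk_mul_of_mem f ha).symm⟩
  have : Finite (G ⧸ H) := Set.finite_univ_iff.mp (hcover ▸ hF.image _)
  exact Subgroup.finiteIndex_of_finite_quotient

theorem Subgroup.dSyndetic_of_finiteIndex {G : Type u} [Group G] (H : Subgroup G)
    [H.FiniteIndex] : DSyndetic (H : Set G) := by
  have : Finite (G ⧸ H) := Subgroup.finite_quotient_of_finiteIndex
  refine ⟨Set.range (Quotient.out : G ⧸ H → G), Set.finite_range (ι := G ⧸ H) _,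
    Set.eq_univ_of_forall fun g => ?_⟩
  obtain ⟨h, hh⟩ := QuotientGroup.mk_out_eq_mul H g
  refine ⟨_, ⟨(g : G ⧸ H), rfl⟩, (h : G)⁻¹, H.inv_mem h.2, ?_⟩
  simp [hh]

theorem Set.Finite.set_pow {M : Type u} [Monoid M] {S : Set M} (hS : S.Finite) (n : ℕ) :
    (S ^ n).Finite := by
  induction n with
  | zero => simp
  | succ n ih => exact pow_succ S n ▸ ih.mul hS

theorem Group.FG.exists_finite_pow_cover (G : Type u) [Group G] [Group.FG G] :
    ∃ S : Set G, S.Finite ∧ 1 ∈ S ∧ ∀ g : G, ∃ n : ℕ, g ∈ S ^ n := by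
  obtain ⟨S, hS, hfin⟩ := Monoid.fg_iff.mp (Group.fg_iff_monoid_fg.mp ‹Group.FG G›)
  refine ⟨insert 1 S, hfin.insert 1, Set.mem_insert _ _, fun g => ?_⟩
  have hg : g ∈ Submonoid.closure S := hS ▸ Submonoid.mem_top g
  induction hg using Submonoid.closure_induction with
  | mem x hx => exact ⟨1, by simpa using Or.inr hx⟩
  | one => exact ⟨0, by simp⟩
  | mul x y _ _ hx hy =>
    obtain ⟨m, hm⟩ := hx
    obtain ⟨n, hn⟩ := hy
    exact ⟨m + n, pow_add (insert 1 S) m n ▸ Set.mul_mem_mul hm hn⟩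

/-- The pairs of points whose translates by elements of `T` lie in `U` simultaneously. -/
def agreeOn {G X : Type u} [Group G] [MulAction G X] (U : Set X) (T : Set G) : Set (X × X) :=
  {p | ∀ s ∈ T, s • p.1 ∈ U ↔ s • p.2 ∈ U}

theorem isClopen_agreeOn {G X : Type u} [Group G] [TopologicalSpace X] [MulAction G X]
    (hc : ∀ g : G, Continuous fun y : X => g • y) {U : Set X} (hU : IsClopen U)
    {T : Set G} (hT : T.Finite) : IsClopen (agreeOn U T) := by
  have heq : agreeOn U T = ⋂ s ∈ T, {p : X × X | s • p.1 ∈ U ↔ s • p.2 ∈ U} := by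
    ext p; simp [agreeOn]
  rw [heq]
  refine hT.isClopen_biInter fun s _ => ?_
  have h1 : IsClopen {p : X × X | s • p.1 ∈ U} := hU.preimage ((hc s).comp continuous_fst)
  have h2 : IsClopen {p : X × X | s • p.2 ∈ U} := hU.preimage ((hc s).comp continuous_snd)
  convert (h1.inter h2).union (h1.compl.inter h2.compl) using 1
  ext p
  simp only [Set.mem_ofPred_eq, Set.mem_union, Set.mem_inter_iff, Set.mem_compl_iff]
  tauto

theorem agreeOn_anti {G X : Type u} [Group G] [MulAction G X] (U : Set X) {T T' : Set G}
    (h : T ⊆ T') : agreeOn U T' ⊆ agreeOn U T := fun _ hp s hs => hp s (h hs)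

/-- Two points separated by `U` cannot be moved by `G` to pairs agreeing on arbitrarily large
finite sets. -/
theorem exists_pow_forall_smul_notMem_agreeOn {G X : Type u} [Group G] [TopologicalSpace X]
    [MulAction G X] (hpt : ∀ x : X, IsRegAPpt G x) {U : Set X} (hU : IsClopen U)
    {S : Set G} (h1 : 1 ∈ S) (hS : ∀ g : G, ∃ n : ℕ, g ∈ S ^ n) {x y : X}
    (hxy : ¬(x ∈ U ↔ y ∈ U)) :
    ∃ n : ℕ, ∀ g : G, (g • x, g • y) ∉ agreeOn U (S ^ n) := by
  have key : ∀ z : X, ∃ H : Subgroup G, H.FiniteIndex ∧ ∀ h ∈ H, (h • z ∈ U ↔ z ∈ U) := by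
    intro z
    by_cases hz : z ∈ U
    · obtain ⟨H, hH, hHU⟩ := hpt z U (hU.isOpen.mem_nhds hz)
      exact ⟨H, Subgroup.finiteIndex_of_dSyndetic hH, fun h hh => iff_of_true (hHU h hh) hz⟩
    · obtain ⟨H, hH, hHU⟩ := hpt z Uᶜ (hU.compl.isOpen.mem_nhds hz)
      exact ⟨H, Subgroup.finiteIndex_of_dSyndetic hH, fun h hh => iff_of_false (hHU h hh) hz⟩
  obtain ⟨H, hH, hHx⟩ := key x
  obtain ⟨K, hK, hKy⟩ := key y
  obtain ⟨F, hF, hFHK⟩ := Subgroup.dSyndetic_of_finiteIndex (H ⊓ K)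
  choose ℓ hℓ using hS
  obtain ⟨n, hn⟩ := (hF.image fun f => ℓ f⁻¹).bddAbove
  refine ⟨n, fun g hg => hxy ?_⟩
  obtain ⟨f, hf, a, ha, rfl⟩ : g ∈ F * ((H ⊓ K : Subgroup G) : Set G) := hFHK ▸ Set.mem_univ g
  have hfn : f⁻¹ ∈ S ^ n :=
    Set.pow_subset_pow_right h1 (hn (Set.mem_image_of_mem _ hf)) (hℓ f⁻¹)
  have := hg _ hfn
  simp only [smul_smul, inv_mul_cancel_left] at this
  rwa [hHx a ha.1, hKy a ha.2] at this

/-- A pair agreeing on the ball of radius `n` but not everywhere has a translate which is separated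
by `U` and has, for each `k ≤ n`, a ball of agreement of radius `k` at distance at most `k + 1`. -/
theorem exists_smul_separated_near_agreeOn {G X : Type u} [Group G] [MulAction G X] {U : Set X}
    {S : Set G} (h1 : 1 ∈ S) {n m : ℕ} {p : X × X} (hn : p ∈ agreeOn U (S ^ n))
    (hm : p ∉ agreeOn U (S ^ m)) :
    ∃ g : G, ¬(g • p.1 ∈ U ↔ g • p.2 ∈ U) ∧
      ∀ k ≤ n, ∃ w ∈ S ^ (k + 1), (w⁻¹ • g • p.1, w⁻¹ • g • p.2) ∈ agreeOn U (S ^ k) := by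
  classical
  have hex : ∃ m, p ∉ agreeOn U (S ^ m) := ⟨m, hm⟩
  have hlt : n < Nat.find hex := by
    by_contra! h
    exact Nat.find_spec hex (agreeOn_anti U (Set.pow_subset_pow_right h1 h) hn)
  obtain ⟨r, hr⟩ := Nat.exists_eq_succ_of_ne_zero (Nat.ne_zero_of_lt hlt)
  have hpr : p ∈ agreeOn U (S ^ r) := by
    have := Nat.find_min hex (m := r) (by omega)
    exact not_not.mp this
  have hpr' : p ∉ agreeOn U (S ^ (r + 1)) := by
    have := Nat.find_spec hex
    rwa [hr] at this
  simp only [agreeOn, Set.mem_ofPred_eq, not_forall] at hpr'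
  obtain ⟨g, hg, hgU⟩ := hpr'
  refine ⟨g, hgU, fun k hk => ?_⟩
  rw [show r + 1 = (k + 1) + (r - k) by omega, pow_add] at hg
  obtain ⟨w, hw, t, ht, rfl⟩ := hg
  refine ⟨w, hw, fun s hs => ?_⟩
  have hst : s * t ∈ S ^ r := by
    rw [show r = k + (r - k) by omega, pow_add]
    exact Set.mul_mem_mul hs ht
  simpa [smul_smul, mul_assoc] using hpr _ hst

theorem exists_agreeOn_pow_subset_agreeOn_univ {G X : Type u} [Group G] [TopologicalSpace X]
    [CompactSpace X] [MulAction G X] (hc : ∀ g : G, Continuous fun y : X => g • y)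
    (hpt : ∀ x : X, IsRegAPpt G x) {U : Set X} (hU : IsClopen U) {S : Set G} (hfin : S.Finite)
    (h1 : 1 ∈ S) (hS : ∀ g : G, ∃ n : ℕ, g ∈ S ^ n) :
    ∃ n : ℕ, agreeOn U (S ^ n) ⊆ agreeOn U (Set.univ : Set G) := by
  by_contra! hcon
  have hpow : ∀ k, (S ^ k).Finite := fun k => hfin.set_pow k
  let D : ℕ → Set (X × X) := fun k =>
    ⋃ w ∈ S ^ (k + 1), (fun p : X × X => (w⁻¹ • p.1, w⁻¹ • p.2)) ⁻¹' agreeOn U (S ^ k)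
  have hD : ∀ k, IsClosed (D k) := fun k => (hpow (k + 1)).isClosed_biUnion fun w _ =>
    (isClopen_agreeOn hc hU (hpow k)).isClosed.preimage
      (((hc w⁻¹).comp continuous_fst).prodMk ((hc w⁻¹).comp continuous_snd))
  let C : ℕ → Set (X × X) := fun n => (agreeOn U ({1} : Set G))ᶜ ∩ ⋂ k ≤ n, D k
  have hC : ∀ n, IsClosed (C n) := fun n =>
    (isClopen_agreeOn hc hU (Set.finite_singleton 1)).compl.isClosed.inter
      (isClosed_biInter fun k _ => hD k)
  obtain ⟨p, hp⟩ := IsCompact.nonempty_iInter_of_sequence_nonempty_isCompact_isClosed C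
    (fun n => Set.inter_subset_inter_right _
      (Set.biInter_subset_biInter_left fun k (hk : k ≤ n) => Nat.le_succ_of_le hk))
    (fun n => by
      obtain ⟨p, hp, hp'⟩ := Set.not_subset.mp (hcon n)
      simp only [agreeOn, Set.mem_univ, true_imp_iff, Set.mem_ofPred_eq, not_forall] at hp'
      obtain ⟨g, hg⟩ := hp'
      obtain ⟨m, hm⟩ := hS g
      obtain ⟨a, ha, hak⟩ :=
        exists_smul_separated_near_agreeOn h1 hp (m := m) fun h => hg (h g hm)
      refine ⟨(a • p.1, a • p.2), by simpa [agreeOn] using ha, ?_⟩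
      simpa [D] using hak)
    (hC 0).isCompact hC
  rw [Set.mem_iInter] at hp
  have hsep : ¬(p.1 ∈ U ↔ p.2 ∈ U) := by simpa [agreeOn] using (hp 0).1
  obtain ⟨n, hn⟩ := exists_pow_forall_smul_notMem_agreeOn hpt hU h1 hS hsep
  obtain ⟨w, -, hw⟩ := Set.mem_iUnion₂.mp (Set.mem_iInter₂.mp (hp n).2 n le_rfl)
  exact hn w⁻¹ hw

theorem finiteIndex_stabilizer_of_isClopen {G X : Type u} [Group G] [Group.FG G]
    [TopologicalSpace X] [CompactSpace X] [MulAction G X]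
    (hc : ∀ g : G, Continuous fun y : X => g • y) (hpt : ∀ x : X, IsRegAPpt G x)
    {U : Set X} (hU : IsClopen U) : (MulAction.stabilizer G U).FiniteIndex := by
  obtain ⟨S, hfin, h1, hS⟩ := Group.FG.exists_finite_pow_cover G
  obtain ⟨n, hn⟩ := exists_agreeOn_pow_subset_agreeOn_univ hc hpt hU hfin h1 hS
  have : Finite ↑(S ^ n) := hfin.set_pow n
  let c : X → Set ↑(S ^ n) := fun x => {s | (s : G) • x ∈ U}
  have horb : (MulAction.orbit G U).Finite := by
    refine (Set.finite_range fun A : Set (Set ↑(S ^ n)) => c ⁻¹' A).subset ?_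
    rintro _ ⟨g, rfl⟩
    refine ⟨c '' (g • U), Set.Subset.antisymm ?_ (Set.subset_preimage_image _ _)⟩
    rintro x ⟨y, hy, hyx⟩
    have hxy : (y, x) ∈ agreeOn U (S ^ n) := fun s hs => Set.ext_iff.mp hyx ⟨s, hs⟩
    rw [Set.mem_smul_set_iff_inv_smul_mem] at hy
    exact Set.mem_smul_set_iff_inv_smul_mem.mpr ((hn hxy g⁻¹ (Set.mem_univ _)).mp hy)
  have : Finite (MulAction.orbit G U) := horb
  have : Finite (G ⧸ MulAction.stabilizer G U) :=
    Finite.of_equiv _ (MulAction.orbitEquivQuotientStabilizer G U)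
  exact Subgroup.finiteIndex_of_finite_quotient

theorem stmt_14 {G X : Type u}
    [Group G] [Group.FG G]
    [UniformSpace X] [CompactSpace X] [T2Space X]
    (hzero : TopologicalSpace.IsTopologicalBasis {s : Set X | IsClopen s})
    [MulAction G X] (hc : ∀ g : G, Continuous fun y : X => g • y)
    (hpt : ∀ x : X, IsRegAPpt G x) :
    RegAPFlow G X := by
  intro α hα
  have hV : ∀ x : X, ∃ V : Set X, IsClopen V ∧ x ∈ V ∧ V ×ˢ V ⊆ α := by
    intro x
    have hx : α ∈ nhds (x, x) := nhds_le_uniformity x hα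
    obtain ⟨W, W', hWo, hxW, hW'o, hxW', hsub⟩ := mem_nhds_prod_iff'.mp hx
    obtain ⟨V, hV, hxV, hVW⟩ :=
      hzero.exists_subset_of_mem_open (Set.mem_inter hxW hxW') (hWo.inter hW'o)
    exact ⟨V, hV, hxV, fun q hq => hsub ⟨(hVW hq.1).1, (hVW hq.2).2⟩⟩
  choose V hVc hxV hVα using hV
  obtain ⟨t, ht⟩ := CompactSpace.elim_nhds_subcover V fun x => (hVc x).isOpen.mem_nhds (hxV x)
  have hfi : (⨅ i : t, MulAction.stabilizer G (V i)).FiniteIndex :=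
    Subgroup.finiteIndex_iInf fun i => finiteIndex_stabilizer_of_isClopen hc hpt (hVc i)
  refine ⟨_, Subgroup.dSyndetic_of_finiteIndex (⨅ i : t, MulAction.stabilizer G (V i)),
    fun x h hh => ?_⟩
  obtain ⟨i, hi, hxi⟩ := Set.mem_iUnion₂.mp (ht ▸ Set.mem_univ x : x ∈ ⋃ i ∈ t, V i)
  have hstab : h • V i = V i := Subgroup.mem_iInf.mp hh ⟨i, hi⟩
  have hhx : h • x ∈ h • V i := Set.smul_mem_smul_set hxi
  exact hVα i ⟨hxi, by rwa [hstab] at hhx⟩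
end
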